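/- arXiv:0811.2475 — 7 statements merged into one kernel-verified Lean document; each statement's English description precedes it below -/
import Mathlib

section
/- In a commutative association scheme with n classes on a finite set X, every Krein parameter q_{ij}^k (0 ≤ i, j, k ≤ n) is a real number and is nonnegative. -/
open Matrix BigOperators
open scoped ComplexOrder

namespace AssocScheme

variable (X : Type*) [Fintype X] [DecidableEq X]

/-- A commutative association scheme with `n` classes on a finite set `X`:
adjacency matrices `A 0, …, A n`, primitive idempotents `E 0, …, E n`,
and intersection numbers `p`. -/
structure Scheme (n : ℕ) where
  A : Fin (n + 1) → Matrix X X ℂ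
  E : Fin (n + 1) → Matrix X X ℂ
  p : Fin (n + 1) → Fin (n + 1) → Fin (n + 1) → ℂ
  A_zeroOne : ∀ i x y, A i x y = 0 ∨ A i x y = 1
  A_zero : A 0 = 1
  A_sum : ∑ i, A i = Matrix.of fun _ _ => (1 : ℂ)
  A_trans : ∀ i, ∃ i', (A i)ᵀ = A i'
  A_mul : ∀ i j, A i * A j = ∑ k, p i j k • A k
  A_comm : ∀ i j, A i * A j = A j * A i
  E_zero : E 0 = (Fintype.card X : ℂ)⁻¹ • Matrix.of fun _ _ => (1 : ℂ)
  E_ne : ∀ i, E i ≠ 0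
  E_herm : ∀ i, (E i).IsHermitian
  E_mul : ∀ i j, E i * E j = if i = j then E i else 0
  E_sum : ∑ i, E i = 1
  E_span : ∀ i, E i ∈ Submodule.span ℂ (Set.range A)

variable {X}
variable {n : ℕ}

/-- The scheme is symmetric: all adjacency matrices are symmetric. -/
def Scheme.IsSym (S : Scheme X n) : Prop := ∀ i, (S.A i)ᵀ = S.A i

/-- `P` is the first eigenmatrix. -/
def Scheme.IsP (S : Scheme X n) (P : Matrix (Fin (n + 1)) (Fin (n + 1)) ℂ) : Prop :=
  ∀ i, S.A i = ∑ j, P j i • S.E j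

/-- `Q` is the second eigenmatrix. -/
def Scheme.IsQ (S : Scheme X n) (Q : Matrix (Fin (n + 1)) (Fin (n + 1)) ℂ) : Prop :=
  ∀ i, S.E i = (Fintype.card X : ℂ)⁻¹ • ∑ j, Q j i • S.A j

/-- `q` is the family of Krein parameters of the scheme. -/
def Scheme.IsKrein (S : Scheme X n) (q : Fin (n + 1) → Fin (n + 1) → Fin (n + 1) → ℂ) : Prop :=
  ∀ i j, Matrix.hadamard (S.E i) (S.E j) = (Fintype.card X : ℂ)⁻¹ • ∑ k, q i j k • S.E k

/-- The scheme is metric (P-polynomial) w.r.t. the given ordering of the `A i`. -/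
def Scheme.Metric (S : Scheme X n) : Prop :=
  ∀ i j k : Fin (n + 1), ((i : ℕ) + (j : ℕ) < (k : ℕ) → S.p i j k = 0) ∧
    ((k : ℕ) = (i : ℕ) + (j : ℕ) → S.p i j k ≠ 0)

/-- The scheme is cometric (Q-polynomial) w.r.t. the given ordering of the `E i`,
with Krein parameters `q`. -/
def Scheme.Cometric (S : Scheme X n) (q : Fin (n + 1) → Fin (n + 1) → Fin (n + 1) → ℂ) : Prop :=
  S.IsKrein q ∧ ∀ i j k : Fin (n + 1), ((i : ℕ) + (j : ℕ) < (k : ℕ) → q i j k = 0) ∧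
    ((k : ℕ) = (i : ℕ) + (j : ℕ) → q i j k ≠ 0)

/-- The scheme is imprimitive: some nontrivial relation is disconnected. -/
def Scheme.Imprimitive (S : Scheme X n) : Prop :=
  ∃ i : Fin (n + 1), i ≠ 0 ∧ ¬ ∀ x y : X, Relation.EqvGen (fun a b => S.A i a b = 1) x y

/-- The inner distribution of a subset `Y`. -/
noncomputable def innerDist (S : Scheme X n) (Y : Finset X) : Fin (n + 1) → ℂ :=
  fun i => (Y.card : ℂ)⁻¹ * ∑ x ∈ Y, ∑ y ∈ Y, S.A i x y

/-- The MacWilliams transform `aQ` of a vector `a`. -/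
noncomputable def macT (Q : Matrix (Fin (n + 1)) (Fin (n + 1)) ℂ) (a : Fin (n + 1) → ℂ) : Fin (n + 1) → ℂ :=
  fun i => ∑ j, a j * Q j i

/-- Entry `B_{x,i}` of the outer distribution of `Y`. -/
noncomputable def outerB (S : Scheme X n) (Y : Finset X) (x : X) (i : Fin (n + 1)) : ℂ :=
  ∑ y ∈ Y, S.A i x y

open scoped Fin.NatCast in
/-- `Y` is completely regular: row `x` of the outer distribution depends only on
`min{j : B_{x,j} ≠ 0}`. -/
def CompletelyRegular (S : Scheme X n) (Y : Finset X) : Prop :=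
  ∀ x x' : X,
    sInf {j : ℕ | outerB S Y x (j : Fin (n + 1)) ≠ 0} =
      sInf {j : ℕ | outerB S Y x' (j : Fin (n + 1)) ≠ 0} →
    ∀ i, outerB S Y x i = outerB S Y x' i

/-- `Y` is regular: `(A_i χ)_x = a_i` for all `x ∈ Y`. -/
def Regular (S : Scheme X n) (Y : Finset X) : Prop :=
  ∀ x ∈ Y, ∀ i, outerB S Y x i = innerDist S Y i

/-- The restriction of the scheme to `Y` (on the `s+1` relations meeting `Y`)
is a symmetric association scheme with `s` classes which is cometric with respect
to some ordering of its primitive idempotents. -/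
def CometricSubscheme (S : Scheme X n) (Y : Finset X) (s : ℕ) : Prop :=
  ∃ f : Fin (s + 1) → Fin (n + 1), Function.Injective f ∧
    (∀ j, f j = 0 ∨ innerDist S Y (f j) ≠ 0) ∧
    (∀ i : Fin (n + 1), (i = 0 ∨ innerDist S Y i ≠ 0) → ∃ j, f j = i) ∧
    ∃ (S' : Scheme {x // x ∈ Y} s) (q' : Fin (s + 1) → Fin (s + 1) → Fin (s + 1) → ℂ),
      (∀ j (y y' : {x // x ∈ Y}), S'.A j y y' = S.A (f j) y.1 y'.1) ∧
      S'.IsSym ∧ S'.Cometric q'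

end AssocScheme

namespace AssocScheme

/-- In a commutative association scheme with `n` classes on a finite set `X`,
every Krein parameter `q_{ij}^k` is real and nonnegative (`0 ≤ q i j k` in the complex
order means precisely: `q i j k` is a nonnegative real number). -/
theorem krein_parameters_real_nonneg {X : Type*} [Fintype X] [DecidableEq X] [Nonempty X]
    {n : ℕ} (hn : 1 ≤ n) (S : Scheme X n)
    (q : Fin (n + 1) → Fin (n + 1) → Fin (n + 1) → ℂ) (hq : S.IsKrein q) :
    ∀ i j k, ∃ r : ℝ, 0 ≤ r ∧ q i j k = (r : ℂ) := by
  intro i j k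
  have hE : ∀ i, (S.E i).PosSemidef := by
    intro i
    have h := posSemidef_conjTranspose_mul_self (S.E i)
    rwa [(S.E_herm i).eq, S.E_mul, if_pos rfl] at h
  have hH := ((hE i).hadamard (hE j)).conjTranspose_mul_mul_same (S.E k)
  have hs : (∑ l, q i j l • S.E l) * S.E k = q i j k • S.E k := by
    rw [Finset.sum_mul, Finset.sum_eq_single k]
    · rw [smul_mul_assoc, S.E_mul, if_pos rfl]
    · intro l _ hl
      rw [smul_mul_assoc, S.E_mul, if_neg hl, smul_zero]
    · simp
  rw [(S.E_herm k).eq, hq i j, mul_assoc, smul_mul_assoc, hs, mul_smul_comm, mul_smul_comm,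
    S.E_mul, if_pos rfl] at hH
  have ht := hH.trace_nonneg
  rw [trace_smul, trace_smul, smul_eq_mul, smul_eq_mul] at ht
  have h0 : 0 ≤ (S.E k).trace := (hE k).trace_nonneg
  have h1 : (S.E k).trace ≠ 0 := by
    intro h
    apply S.E_ne k
    rw [← trace_conjTranspose_mul_self_eq_zero_iff, (S.E_herm k).eq, S.E_mul, if_pos rfl, h]
  have hp : 0 < (S.E k).trace := lt_of_le_of_ne h0 (Ne.symm h1)
  have hc : (0 : ℂ) < (Fintype.card X : ℂ)⁻¹ := by
    have h2 : (0 : ℝ) < (Fintype.card X : ℝ)⁻¹ := by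
      have := Fintype.card_pos (α := X)
      positivity
    have h3 : (0 : ℂ) < (((Fintype.card X : ℝ)⁻¹ : ℝ) : ℂ) := by exact_mod_cast h2
    simpa using h3
  have hn' : 0 ≤ q i j k :=
    le_of_mul_le_mul_of_pos_right (by simpa using le_of_mul_le_mul_of_pos_left (by simpa using ht) hc) hp
  exact ⟨(q i j k).re, (Complex.nonneg_iff.1 hn').1,
    Complex.ext (by simp) (by simpa using (Complex.nonneg_iff.1 hn').2.symm)⟩

end AssocScheme
end

section
/- For a commutative association scheme with n ≥ 1 classes on a finite set X, the following are equivalent: (i) the scheme is imprimitive, i.e., for some i ∈ {1,…,n} the relation R_i = {(x,y) ∈ X×X : (A_i)_{xy} = 1} is disconnected (the reflexive-symmetric-transitive closure of R_i is not all of X × X); (ii) there exist a subset I ⊆ {0,1,…,n} and an equivalence relation ~ on X having r ≥ 2 classes, all of the same size s ≥ 2, such that (Σ_{i∈I} A_i)_{xy} = 1 when x ~ y and = 0 otherwise; (iii) there exist a subset J ⊆ {0,1,…,n} and an equivalence relation ~ on X having r ≥ 2 classes, all of the same size s ≥ 2, such that (Σ_{i∈J} E_i)_{xy} = 1/s when x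 ~ y and = 0 otherwise; (iv) there exist i ∈ {1,…,n} and distinct x, y ∈ X such that the x-th and y-th columns of E_i are equal. -/
open Matrix BigOperators
open scoped ComplexOrder

namespace AssocScheme

section Helpers

variable {X : Type*} [Fintype X] [DecidableEq X] {n : ℕ}

theorem exists_color (S : Scheme X n) :
    ∃ c : X → X → Fin (n + 1), ∀ k x y, S.A k x y = if c x y = k then 1 else 0 := by
  have key : ∀ x y, ∃ k0, ∀ k, S.A k x y = if k0 = k then 1 else 0 := by
    intro x y
    have h1 : ∑ k, S.A k x y = 1 := by
      have := congrFun (congrFun S.A_sum x) y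
      simpa [Matrix.sum_apply] using this
    have h2 : ∀ k, S.A k x y = if S.A k x y = 1 then 1 else 0 := by
      intro k
      rcases S.A_zeroOne k x y with h | h <;> simp [h]
    rw [Finset.sum_congr rfl (fun k _ => h2 k), Finset.sum_boole] at h1
    have h3 : (Finset.univ.filter fun k => S.A k x y = 1).card = 1 := by exact_mod_cast h1
    obtain ⟨k0, hk0⟩ := Finset.card_eq_one.mp h3
    refine ⟨k0, fun k => ?_⟩
    have : S.A k x y = 1 ↔ k = k0 := by
      have := Finset.ext_iff.mp hk0 k
      simpa using this
    rw [h2 k]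
    simp only [this, eq_comm]
  choose c hc using key
  exact ⟨c, fun k x y => hc x y k⟩

/-- The relation-index function. -/
noncomputable def col (S : Scheme X n) : X → X → Fin (n + 1) := (exists_color S).choose

theorem col_spec (S : Scheme X n) (k : Fin (n + 1)) (x y : X) :
    S.A k x y = if col S x y = k then 1 else 0 := (exists_color S).choose_spec k x y

theorem col_zero (S : Scheme X n) (x y : X) : col S x y = 0 ↔ x = y := by
  have h := col_spec S 0 x y
  rw [S.A_zero, Matrix.one_apply] at h
  by_cases h1 : x = y <;> by_cases h2 : col S x y = 0 <;> simp_all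

theorem col_symm (S : Scheme X n) {x y x' y' : X} (h : col S x y = col S x' y') :
    col S y x = col S y' x' := by
  obtain ⟨k, hk⟩ := S.A_trans (col S y x)
  have h1 : ∀ a b, S.A (col S y x) b a = S.A k a b := fun a b => congrFun (congrFun hk a) b
  have h2 := h1 x y
  have h3 := h1 x' y'
  rw [col_spec, col_spec] at h2 h3
  rw [← h] at h3
  by_contra hne
  rw [if_neg (Ne.symm hne)] at h3
  rw [if_pos rfl, ← h3] at h2
  simp at h2

theorem col_mul (S : Scheme X n) (i j : Fin (n + 1)) (x y : X) :
    ∑ z, (if col S x z = i then 1 else 0) * (if col S z y = j then 1 else 0) =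
      S.p i j (col S x y) := by
  have h := congrFun (congrFun (S.A_mul i j) x) y
  rw [Matrix.mul_apply, Matrix.sum_apply] at h
  simpa [col_spec] using h

theorem col_comp (S : Scheme X n) {x y x' y' : X} (h : col S x y = col S x' y') (z : X) :
    ∃ z', col S x z = col S x' z' ∧ col S z y = col S z' y' := by
  by_contra hne
  push Not at hne
  have h1 := col_mul S (col S x z) (col S z y) x y
  have h2 := col_mul S (col S x z) (col S z y) x' y'
  rw [← h, ← h1] at h2
  rw [Finset.sum_eq_zero] at h2
  · have h3 : ∀ w, ((if col S x w = col S x z then (1:ℂ) else 0) *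
        (if col S w y = col S z y then 1 else 0)) =
        if (col S x w = col S x z ∧ col S w y = col S z y) then 1 else 0 := by
      intro w
      by_cases a : col S x w = col S x z <;> by_cases b : col S w y = col S z y <;> simp [a, b]
    simp only [h3] at h2
    rw [Finset.sum_boole] at h2
    have h4 : (Finset.univ.filter fun w => col S x w = col S x z ∧ col S w y = col S z y).card
        = 0 := by exact_mod_cast h2.symm
    rw [Finset.card_eq_zero] at h4
    have : z ∈ (Finset.univ.filter fun w => col S x w = col S x z ∧ col S w y = col S z y) := by
      simp
    rw [h4] at this
    simp at this
  · intro w _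
    by_cases a : col S x' w = col S x z
    · have := hne w a.symm
      simp [Ne.symm this]
    · simp [a]

theorem mem_iff (S : Scheme X n) (M : Matrix X X ℂ) :
    M ∈ Submodule.span ℂ (Set.range S.A) ↔ ∃ f : Fin (n + 1) → ℂ, ∀ x y, M x y = f (col S x y) := by
  rw [Submodule.mem_span_range_iff_exists_fun]
  refine exists_congr fun f => ?_
  have h : ∀ x y, (∑ i, f i • S.A i) x y = f (col S x y) := by
    intro x y
    simp [Matrix.sum_apply, col_spec]
  constructor
  · rintro rfl
    exact h
  · intro h'
    ext x y
    rw [h, h']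

theorem E_indep (S : Scheme X n) : LinearIndependent ℂ S.E := by
  rw [Fintype.linearIndependent_iff]
  intro g hg i
  have h := congrArg (fun M => S.E i * M) hg
  simp only [Finset.mul_sum, Matrix.mul_smul, S.E_mul, Matrix.mul_zero] at h
  simp at h
  exact h.resolve_right (S.E_ne i)

theorem span_eq (S : Scheme X n) :
    Submodule.span ℂ (Set.range S.E) = Submodule.span ℂ (Set.range S.A) := by
  apply Submodule.eq_of_le_of_finrank_le
  · rw [Submodule.span_le]
    rintro _ ⟨i, rfl⟩
    exact S.E_span i
  · rw [finrank_span_eq_card (E_indep S)]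
    exact finrank_range_le_card S.A

theorem A_indep (S : Scheme X n) : LinearIndependent ℂ S.A := by
  rw [linearIndependent_iff_card_eq_finrank_span, Set.finrank, ← span_eq,
    finrank_span_eq_card (E_indep S)]

theorem col_surj (S : Scheme X n) (k : Fin (n + 1)) : ∃ x y, col S x y = k := by
  by_contra h
  push Not at h
  apply (A_indep S).ne_zero k
  ext x y
  simp [col_spec, h]

theorem valency (S : Scheme X n) (k : Fin (n + 1)) (x x' : X) :
    ∑ y, S.A k x y = ∑ y, S.A k x' y := by
  obtain ⟨k', hk⟩ := S.A_trans k
  have h1 : ∀ x, ∑ y, S.A k x y = S.p k k' 0 := by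
    intro x
    have h := congrFun (congrFun (S.A_mul k k') x) x
    rw [← hk, Matrix.mul_apply, Matrix.sum_apply] at h
    have hz : col S x x = 0 := (col_zero S x x).2 rfl
    have h2 : ∑ l, (S.p k k' l • S.A l) x x = S.p k k' 0 := by
      simp [col_spec, hz]
    rw [h2] at h
    rw [← h]
    refine Finset.sum_congr rfl fun y _ => ?_
    rw [Matrix.transpose_apply]
    rcases S.A_zeroOne k x y with h | h <;> simp [h]
  rw [h1, h1]

/-- A nontrivial equivalence relation that is a union of relations of the scheme. -/
structure Good (S : Scheme X n) (e : Setoid X) : Prop where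
  inv : ∀ x y x' y', col S x y = col S x' y' → e.r x y → e.r x' y'
  nbot : ∃ x y, x ≠ y ∧ e.r x y
  ntop : ∃ x y, ¬ e.r x y

/-- The numerical conditions on the equivalence relation. -/
def Num (e : Setoid X) (r s : ℕ) : Prop :=
  2 ≤ r ∧ 2 ≤ s ∧ Nat.card (Quotient e) = r ∧ (∀ x : X, Nat.card {y : X | e.r x y} = s)

open Classical in
theorem ncard_eq (e : Setoid X) (x : X) :
    (Nat.card {y : X | e.r x y} : ℂ) = ∑ y, if e.r x y then 1 else 0 := by
  rw [Finset.sum_boole, Nat.card_eq_fintype_card, Fintype.card_subtype]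
  rfl

theorem good_num (S : Scheme X n) {e : Setoid X} (h : Good S e) : ∃ r s, Num e r s := by
  classical
  obtain ⟨x0, y0, hne, h0⟩ := h.nbot
  obtain ⟨x1, y1, h1⟩ := h.ntop
  refine ⟨_, Nat.card {y : X | e.r x0 y}, ?_, ?_, rfl, ?_⟩
  · rw [Nat.card_eq_fintype_card]
    apply Nat.succ_le_of_lt
    rw [Fintype.one_lt_card_iff]
    exact ⟨Quotient.mk e x1, Quotient.mk e y1, fun hh => h1 (Quotient.exact hh)⟩
  · rw [Nat.card_eq_fintype_card]
    apply Nat.succ_le_of_lt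
    rw [Fintype.one_lt_card_iff]
    exact ⟨⟨x0, e.refl x0⟩, ⟨y0, h0⟩, fun hh => hne (congrArg Subtype.val hh)⟩
  · intro x
    have key : ∀ x, (Nat.card {y : X | e.r x y} : ℂ) =
        ∑ k, (if ∃ a b, col S a b = k ∧ e.r a b then 1 else 0) * ∑ y, S.A k x y := by
      intro x
      rw [ncard_eq]
      simp only [Finset.mul_sum]
      rw [Finset.sum_comm]
      refine Finset.sum_congr rfl fun y _ => ?_
      simp only [col_spec, mul_ite, mul_one, mul_zero, Finset.sum_ite_eq, Finset.mem_univ, if_true]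
      congr 1
      apply propext
      exact ⟨fun hh => ⟨x, y, rfl, hh⟩, fun ⟨a, b, h2, h3⟩ => h.inv _ _ _ _ h2 h3⟩
    have : (Nat.card {y : X | e.r x y} : ℂ) = (Nat.card {y : X | e.r x0 y} : ℂ) := by
      rw [key, key]
      refine Finset.sum_congr rfl fun k _ => ?_
      rw [valency S k x x0]
    exact_mod_cast this

theorem num_nbot [Nonempty X] {e : Setoid X} {r s : ℕ} (h : Num e r s) :
    ∃ x y, x ≠ y ∧ e.r x y := by
  classical
  obtain ⟨x⟩ := ‹Nonempty X›
  have h1 := h.2.2.2 x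
  have h2 := h.2.1
  rw [← h1, Nat.card_eq_fintype_card] at h2
  obtain ⟨⟨y, hy⟩, hne⟩ := Fintype.exists_ne_of_one_lt_card h2 ⟨x, e.refl x⟩
  exact ⟨x, y, fun hh => hne (Subtype.ext hh.symm), hy⟩

theorem num_ntop {e : Setoid X} {r s : ℕ} (h : Num e r s) : ∃ x y, ¬ e.r x y := by
  classical
  have h1 := h.1
  rw [← h.2.2.1, Nat.card_eq_fintype_card] at h1
  obtain ⟨a, b, hab⟩ := Fintype.one_lt_card_iff.mp h1
  induction a using Quotient.inductionOn with | _ a => ?_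
  induction b using Quotient.inductionOn with | _ b => ?_
  exact ⟨a, b, fun hh => hab (Quotient.sound hh)⟩

theorem sumA (S : Scheme X n) (I : Finset (Fin (n + 1))) (x y : X) :
    (∑ i ∈ I, S.A i) x y = if col S x y ∈ I then 1 else 0 := by
  simp [Matrix.sum_apply, col_spec]

/-- Invariance from a matrix in the span vanishing exactly off `e`. -/
theorem inv_of_mem (S : Scheme X n) {e : Setoid X} {M : Matrix X X ℂ}
    (hM : M ∈ Submodule.span ℂ (Set.range S.A)) (he : ∀ x y, e.r x y ↔ M x y ≠ 0)
    (x y x' y' : X) (h : col S x y = col S x' y') (h' : e.r x y) : e.r x' y' := by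
  obtain ⟨f, hf⟩ := (mem_iff S M).1 hM
  rw [he, hf] at *
  rwa [← h]

theorem good_iff_two [Nonempty X] (S : Scheme X n) (e : Setoid X) : Good S e ↔
    ∃ (I : Finset (Fin (n + 1))) (r s : ℕ), Num e r s ∧
        ∀ x y : X, (e.r x y → (∑ i ∈ I, S.A i) x y = 1) ∧
          (¬ e.r x y → (∑ i ∈ I, S.A i) x y = 0) := by
  classical
  constructor
  · intro h
    obtain ⟨r, s, hrs⟩ := good_num S h
    refine ⟨Finset.univ.filter fun k => ∃ a b, col S a b = k ∧ e.r a b, r, s, hrs, ?_⟩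
    intro x y
    rw [sumA]
    constructor
    · intro hh
      rw [if_pos]
      simp only [Finset.mem_filter, Finset.mem_univ, true_and]
      exact ⟨x, y, rfl, hh⟩
    · intro hh
      rw [if_neg]
      simp only [Finset.mem_filter, Finset.mem_univ, true_and]
      rintro ⟨a, b, h2, h3⟩
      exact hh (h.inv _ _ _ _ h2 h3)
  · rintro ⟨I, r, s, hrs, h⟩
    refine ⟨inv_of_mem S (M := ∑ i ∈ I, S.A i) ?_ ?_, num_nbot hrs, num_ntop hrs⟩
    · exact Submodule.sum_mem _ fun i _ => Submodule.subset_span ⟨i, rfl⟩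
    · intro x y
      by_cases hh : e.r x y
      · simp [hh, (h x y).1 hh]
      · simp [hh, (h x y).2 hh]

theorem good_iff_three [Nonempty X] (S : Scheme X n) (e : Setoid X) : Good S e ↔
    ∃ (J : Finset (Fin (n + 1))) (r s : ℕ), Num e r s ∧
        ∀ x y : X, (e.r x y → (∑ i ∈ J, S.E i) x y = (s : ℂ)⁻¹) ∧
          (¬ e.r x y → (∑ i ∈ J, S.E i) x y = 0) := by
  classical
  constructor
  · intro h
    obtain ⟨r, s, hrs⟩ := good_num S h
    have hs : (s : ℂ) ≠ 0 := by
      have := hrs.2.1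
      exact_mod_cast (by omega : s ≠ 0)
    let M : Matrix X X ℂ := Matrix.of fun x y => if e.r x y then (s : ℂ)⁻¹ else 0
    have hMV : M ∈ Submodule.span ℂ (Set.range S.A) := by
      rw [mem_iff]
      refine ⟨fun k => if ∃ a b, col S a b = k ∧ e.r a b then (s : ℂ)⁻¹ else 0, fun x y => ?_⟩
      simp only [M, Matrix.of_apply]
      congr 1
      apply propext
      exact ⟨fun hh => ⟨x, y, rfl, hh⟩, fun ⟨a, b, h2, h3⟩ => h.inv _ _ _ _ h2 h3⟩
    have hMM : M * M = M := by
      ext x y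
      rw [Matrix.mul_apply]
      simp only [M, Matrix.of_apply]
      by_cases hxy : e.r x y
      · have h1 : ∀ z, ((if e.r x z then (s : ℂ)⁻¹ else 0) * if e.r z y then (s : ℂ)⁻¹ else 0) =
            ((s : ℂ)⁻¹ * (s : ℂ)⁻¹) * if e.r x z then 1 else 0 := by
          intro z
          by_cases hz : e.r x z
          · have : e.r z y := e.trans (e.symm hz) hxy
            simp [hz, this]
          · simp [hz]
        simp only [h1]
        rw [← Finset.mul_sum, ← ncard_eq, hrs.2.2.2 x, if_pos hxy]
        field_simp
      · rw [if_neg hxy]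
        refine Finset.sum_eq_zero fun z _ => ?_
        by_cases hz : e.r x z
        · have : ¬ e.r z y := fun hh => hxy (e.trans hz hh)
          simp [this]
        · simp [hz]
    rw [← span_eq, Submodule.mem_span_range_iff_exists_fun] at hMV
    obtain ⟨g, hg⟩ := hMV
    have hEM : ∀ i, S.E i * M = g i • S.E i := by
      intro i
      rw [← hg]
      simp [Finset.mul_sum, S.E_mul]
    have hgg : ∀ i, g i = 0 ∨ g i = 1 := by
      intro i
      have h1 : S.E i * (M * M) = (g i * g i) • S.E i := by
        rw [← Matrix.mul_assoc, hEM, Matrix.smul_mul, hEM, smul_smul]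
      rw [hMM, hEM] at h1
      have h2 := smul_left_injective ℂ (S.E_ne i) h1
      by_cases h3 : g i = 0
      · exact Or.inl h3
      · right
        exact (mul_left_cancel₀ h3 (by rw [mul_one]; exact h2)).symm
    have hJ : ∑ i ∈ Finset.univ.filter (fun i => g i = 1), S.E i = M := by
      rw [← hg, Finset.sum_filter]
      refine Finset.sum_congr rfl fun i _ => ?_
      rcases hgg i with h | h <;> simp [h]
    refine ⟨Finset.univ.filter (fun i => g i = 1), r, s, hrs, fun x y => ?_⟩
    rw [hJ]
    exact ⟨fun hh => by simp only [M, Matrix.of_apply, if_pos hh],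
      fun hh => by simp only [M, Matrix.of_apply, if_neg hh]⟩
  · rintro ⟨J, r, s, hrs, h⟩
    have hs : (s : ℂ) ≠ 0 := by
      have := hrs.2.1
      exact_mod_cast (by omega : s ≠ 0)
    refine ⟨inv_of_mem S (M := ∑ i ∈ J, S.E i) ?_ ?_, num_nbot hrs, num_ntop hrs⟩
    · exact Submodule.sum_mem _ fun i _ => S.E_span i
    · intro x y
      by_cases hh : e.r x y
      · simp [hh, (h x y).1 hh, hs]
      · simp [hh, (h x y).2 hh]

theorem good_of_imprimitive (S : Scheme X n) (h : S.Imprimitive) : ∃ e, Good S e := by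
  obtain ⟨i, hi, h⟩ := h
  push Not at h
  refine ⟨Relation.EqvGen.setoid fun a b => S.A i a b = 1, ?_, ?_, h⟩
  · intro x y x' y' hc hxy
    change Relation.EqvGen _ _ _ at hxy
    change Relation.EqvGen _ _ _
    induction hxy generalizing x' y' with
    | rel a b hab =>
      apply Relation.EqvGen.rel
      rw [col_spec] at hab ⊢
      rwa [← hc]
    | refl a =>
      rw [(col_zero S a a).2 rfl] at hc
      rw [(col_zero S x' y').1 hc.symm]
      exact Relation.EqvGen.refl _
    | symm a b _ ih => exact Relation.EqvGen.symm _ _ (ih _ _ (col_symm S hc))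
    | trans a b c _ _ ih1 ih2 =>
      obtain ⟨z, h1, h2⟩ := col_comp S hc b
      exact Relation.EqvGen.trans _ _ _ (ih1 _ _ h1) (ih2 _ _ h2)
  · obtain ⟨x, y, hxy⟩ := col_surj S i
    refine ⟨x, y, ?_, ?_⟩
    · intro hh
      rw [← col_zero S] at hh
      exact hi (hxy.symm.trans hh)
    · apply Relation.EqvGen.rel
      rw [col_spec, if_pos hxy]

theorem imprimitive_of_good (S : Scheme X n) {e : Setoid X} (h : Good S e) : S.Imprimitive := by
  obtain ⟨x, y, hne, hxy⟩ := h.nbot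
  obtain ⟨x1, y1, h1⟩ := h.ntop
  refine ⟨col S x y, fun hh => hne ((col_zero S x y).1 hh), fun hall => h1 ?_⟩
  have key : ∀ a b, Relation.EqvGen (fun a b => S.A (col S x y) a b = 1) a b → e.r a b := by
    intro a b hab
    induction hab with
    | rel a b hab =>
      rw [col_spec] at hab
      refine h.inv _ _ _ _ ?_ hxy
      by_contra hc
      rw [if_neg (Ne.symm hc)] at hab
      simp at hab
    | refl a => exact e.refl a
    | symm a b _ ih => exact e.symm ih
    | trans a b c _ _ ih1 ih2 => exact e.trans ih1 ih2
  exact key _ _ (hall x1 y1)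

theorem good_of_cols [Nonempty X] (S : Scheme X n)
    (h : ∃ i : Fin (n + 1), i ≠ 0 ∧ ∃ x y : X, x ≠ y ∧ ∀ z : X, S.E i z x = S.E i z y) :
    ∃ e, Good S e := by
  obtain ⟨i, hi, x, y, hne, hxy⟩ := h
  refine ⟨⟨fun x y => ∀ z, S.E i z x = S.E i z y, fun _ _ => rfl, fun h z => (h z).symm,
    fun h h' z => (h z).trans (h' z)⟩, ?_, ⟨x, y, hne, hxy⟩, ?_⟩
  · intro a b a' b' hc hab z'
    obtain ⟨f, hf⟩ := (mem_iff S _).1 (S.E_span i)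
    obtain ⟨z, h1, h2⟩ := col_comp S hc.symm z'
    have := hab z
    rw [hf, hf] at this
    rw [hf, hf, col_symm S h1, h2, this]
  · by_contra hall
    push Not at hall
    apply S.E_ne i
    ext a b
    have h1 := congrFun (congrFun (S.E_mul i 0) a) b
    rw [if_neg hi, S.E_zero, Matrix.mul_apply] at h1
    have h2 : ∀ z, S.E i a z = S.E i a b := fun z => hall z b a
    simp [h2] at h1
    simpa using h1

theorem cols_of_good [Nonempty X] (S : Scheme X n) {e : Setoid X} (h : Good S e) :
    ∃ i : Fin (n + 1), i ≠ 0 ∧ ∃ x y : X, x ≠ y ∧ ∀ z : X, S.E i z x = S.E i z y := by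
  obtain ⟨J, r, s, hrs, hJ⟩ := (good_iff_three S e).1 h
  obtain ⟨x, y, hne, hxy⟩ := h.nbot
  obtain ⟨x1, y1, h1⟩ := h.ntop
  have hs : (s : ℂ) ≠ 0 := by
    have := hrs.2.1
    exact_mod_cast (by omega : s ≠ 0)
  have hex : ∃ i ∈ J, i ≠ 0 := by
    by_contra hcon
    push Not at hcon
    have hc : (∑ i ∈ J, S.E i) x1 y1 = (∑ i ∈ J, S.E i) x1 x1 := by
      rw [Matrix.sum_apply, Matrix.sum_apply]
      refine Finset.sum_congr rfl fun i hi => ?_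
      rw [hcon i hi, S.E_zero]
      rfl
    rw [(hJ x1 y1).2 h1, (hJ x1 x1).1 (e.refl x1)] at hc
    exact inv_ne_zero hs hc.symm
  obtain ⟨i, hiJ, hi⟩ := hex
  refine ⟨i, hi, x, y, hne, fun z => ?_⟩
  have hE : S.E i * (∑ j ∈ J, S.E j) = S.E i := by
    simp [Finset.mul_sum, S.E_mul, hiJ]
  have hcol : ∀ w, (∑ i ∈ J, S.E i) w x = (∑ i ∈ J, S.E i) w y := by
    intro w
    by_cases hw : e.r w x
    · rw [(hJ w x).1 hw, (hJ w y).1 (e.trans hw hxy)]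
    · rw [(hJ w x).2 hw, (hJ w y).2 (fun hh => hw (e.trans hh (e.symm hxy)))]
  rw [← hE, Matrix.mul_apply, Matrix.mul_apply]
  exact Finset.sum_congr rfl fun w _ => by rw [hcol w]

end Helpers

/-- characterizations of imprimitivity. -/
theorem imprimitivity_tfae {X : Type*} [Fintype X] [DecidableEq X] [Nonempty X]
    {n : ℕ} (hn : 1 ≤ n) (S : Scheme X n) :
    [ -- (i) the scheme is imprimitive
      S.Imprimitive,
      -- (ii) some sum of adjacency matrices is the indicator of a nontrivial
      -- equivalence relation with r ≥ 2 classes, all of size s ≥ 2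
      ∃ (I : Finset (Fin (n + 1))) (e : Setoid X) (r s : ℕ), 2 ≤ r ∧ 2 ≤ s ∧
        Nat.card (Quotient e) = r ∧ (∀ x : X, Nat.card {y : X | e.r x y} = s) ∧
        ∀ x y : X, (e.r x y → (∑ i ∈ I, S.A i) x y = 1) ∧
          (¬ e.r x y → (∑ i ∈ I, S.A i) x y = 0),
      -- (iii) some sum of primitive idempotents equals s⁻¹ times such an indicator
      ∃ (J : Finset (Fin (n + 1))) (e : Setoid X) (r s : ℕ), 2 ≤ r ∧ 2 ≤ s ∧
        Nat.card (Quotient e) = r ∧ (∀ x : X, Nat.card {y : X | e.r x y} = s) ∧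
        ∀ x y : X, (e.r x y → (∑ i ∈ J, S.E i) x y = (s : ℂ)⁻¹) ∧
          (¬ e.r x y → (∑ i ∈ J, S.E i) x y = 0),
      -- (iv) some nontrivial E_i has two equal columns
      ∃ i : Fin (n + 1), i ≠ 0 ∧ ∃ x y : X, x ≠ y ∧ ∀ z : X, S.E i z x = S.E i z y
    ].TFAE := by
  have h2 : (∃ e, Good S e) ↔ _ := exists_congr fun e => good_iff_two S e
  have h3 : (∃ e, Good S e) ↔ _ := exists_congr fun e => good_iff_three S e
  tfae_have 1 → 2 := by
    intro h
    obtain ⟨e, I, r, s, ⟨a, b, c, d⟩, h⟩ := h2.1 (good_of_imprimitive S h)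
    exact ⟨I, e, r, s, a, b, c, d, h⟩
  tfae_have 2 → 3 := by
    rintro ⟨I, e, r, s, a, b, c, d, h⟩
    obtain ⟨e, I, r, s, ⟨a, b, c, d⟩, h⟩ := h3.1 (h2.2 ⟨e, I, r, s, ⟨a, b, c, d⟩, h⟩)
    exact ⟨I, e, r, s, a, b, c, d, h⟩
  tfae_have 3 → 4 := by
    rintro ⟨I, e, r, s, a, b, c, d, h⟩
    obtain ⟨e, he⟩ := h3.2 ⟨e, I, r, s, ⟨a, b, c, d⟩, h⟩
    exact cols_of_good S he
  tfae_have 4 → 1 := by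
    intro h
    obtain ⟨e, he⟩ := good_of_cols S h
    exact imprimitive_of_good S he
  tfae_finish

end AssocScheme
end

section
/- Let (X, R) be a symmetric association scheme with n classes, let Y ⊆ X be a T-code with inner distribution a, and let Z ⊆ X be a U-code with inner distribution b, where T ∪ U = {1, 2, …, n}. Then |Y| · |Z| ≤ |X|, with equality if and only if (aQ)_i · (bQ)_i = 0 for all 1 ≤ i ≤ n. -/
open Matrix BigOperators
open scoped ComplexOrder

namespace AssocScheme

section Helpers

variable {X : Type*} [Fintype X] [DecidableEq X] {n : ℕ}

/-- Distinct adjacency matrices have disjoint supports. -/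
lemma A_mul_entry (S : Scheme X n) (k l : Fin (n + 1)) (x y : X) :
    S.A k x y * S.A l x y = if k = l then S.A k x y else 0 := by
  split_ifs with h
  · subst h
    rcases S.A_zeroOne k x y with h | h <;> simp [h]
  · rcases S.A_zeroOne k x y with hk | hk
    · simp [hk]
    rcases S.A_zeroOne l x y with hl | hl
    · simp [hl]
    exfalso
    have hs : ∑ i, S.A i x y = 1 := by
      have := congrFun (congrFun S.A_sum x) y
      simpa [Matrix.sum_apply] using this
    have hs' : ∑ i, (S.A i x y).re = 1 := by
      rw [← Complex.re_sum, hs]; simp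
    have hle : ∑ i ∈ ({k, l} : Finset (Fin (n + 1))), (S.A i x y).re ≤ ∑ i, (S.A i x y).re := by
      apply Finset.sum_le_sum_of_subset_of_nonneg (Finset.subset_univ _)
      intro i _ _
      rcases S.A_zeroOne i x y with h | h <;> simp [h]
    rw [Finset.sum_pair h, hs', hk, hl] at hle
    norm_num at hle

/-- Sum of the entries of `A k`. -/
noncomputable def tot (S : Scheme X n) (k : Fin (n + 1)) : ℂ := ∑ x, ∑ y, S.A k x y

lemma trace_A_mul (S : Scheme X n) (hsym : S.IsSym) (k l : Fin (n + 1)) :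
    (S.A k * S.A l).trace = if k = l then tot S k else 0 := by
  have h1 : (S.A k * S.A l).trace = ∑ x, ∑ y, S.A k x y * S.A l x y := by
    simp only [Matrix.trace, Matrix.diag_apply, Matrix.mul_apply]
    refine Finset.sum_congr rfl fun x _ => Finset.sum_congr rfl fun y _ => ?_
    rw [← congrFun (congrFun (hsym l) x) y, Matrix.transpose_apply]
  rw [h1]
  simp only [A_mul_entry]
  split_ifs <;> simp [tot]

lemma E_psd (S : Scheme X n) (i : Fin (n + 1)) : (S.E i).PosSemidef := by
  have h := Matrix.posSemidef_conjTranspose_mul_self (S.E i)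
  rwa [(S.E_herm i).eq, S.E_mul, if_pos rfl] at h

lemma trace_E_pos (S : Scheme X n) (i : Fin (n + 1)) : 0 < (S.E i).trace := by
  refine lt_of_le_of_ne (E_psd S i).trace_nonneg fun h => S.E_ne i ?_
  exact (E_psd S i).trace_eq_zero_iff.1 h.symm

lemma sum_E_nonneg (S : Scheme X n) (i : Fin (n + 1)) (Y : Finset X) :
    0 ≤ ∑ x ∈ Y, ∑ y ∈ Y, S.E i x y := by
  have h := (E_psd S i).dotProduct_mulVec_nonneg (fun x => if x ∈ Y then (1 : ℂ) else 0)
  simpa [dotProduct, Matrix.mulVec, apply_ite, Finset.sum_ite_mem] using h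

lemma macT_eq [Nonempty X] (S : Scheme X n) (Q : Matrix (Fin (n + 1)) (Fin (n + 1)) ℂ)
    (hQ : S.IsQ Q) (Y : Finset X) (i : Fin (n + 1)) :
    macT Q (innerDist S Y) i =
      (Fintype.card X : ℂ) * (Y.card : ℂ)⁻¹ * ∑ x ∈ Y, ∑ y ∈ Y, S.E i x y := by
  have hN : (Fintype.card X : ℂ) ≠ 0 := by simp
  have hE : ∀ x y, S.E i x y = (Fintype.card X : ℂ)⁻¹ * ∑ j, Q j i * S.A j x y := by
    intro x y
    conv_lhs => rw [hQ i]
    simp [Matrix.sum_apply]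
  have h2 : ∑ x ∈ Y, ∑ y ∈ Y, S.E i x y =
      (Fintype.card X : ℂ)⁻¹ * ∑ j, Q j i * ∑ x ∈ Y, ∑ y ∈ Y, S.A j x y := by
    simp only [hE, ← Finset.mul_sum]
    congr 1
    simp only [Finset.mul_sum]
    rw [Finset.sum_comm]
    conv_rhs => rw [Finset.sum_comm]
    rw [Finset.sum_comm]
    refine Finset.sum_congr rfl fun x _ => ?_
    rw [Finset.sum_comm]
  rw [h2]
  simp only [macT, innerDist]
  rw [mul_right_comm, mul_inv_cancel_left₀ hN, mul_comm, Finset.mul_sum]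
  refine Finset.sum_congr rfl fun j _ => ?_
  ring

/-- Orthogonality: `Q M⁻¹ Qᵀ S = N²`. -/
lemma orth [Nonempty X] (S : Scheme X n) (hsym : S.IsSym)
    (Q : Matrix (Fin (n + 1)) (Fin (n + 1)) ℂ) (hQ : S.IsQ Q) :
    (Q * Matrix.diagonal (fun i => ((S.E i).trace)⁻¹) * Qᵀ) * Matrix.diagonal (tot S) =
      ((Fintype.card X : ℂ) ^ 2) • (1 : Matrix (Fin (n + 1)) (Fin (n + 1)) ℂ) := by
  have hN : (Fintype.card X : ℂ) ≠ 0 := by simp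
  have h1 : Qᵀ * Matrix.diagonal (tot S) * Q =
      ((Fintype.card X : ℂ) ^ 2) • Matrix.diagonal (fun i => (S.E i).trace) := by
    ext i j
    have h : (S.E i * S.E j).trace =
        ((Fintype.card X : ℂ) ^ 2)⁻¹ * ∑ k, Q k i * tot S k * Q k j := by
      rw [hQ i, hQ j]
      simp only [Matrix.smul_mul, Matrix.mul_smul, Matrix.trace_smul, Finset.sum_mul,
        Finset.mul_sum, Matrix.trace_sum, trace_A_mul S hsym, smul_eq_mul]
      refine Finset.sum_congr rfl fun k _ => ?_
      simp only [mul_ite, mul_zero, Finset.sum_ite_eq, Finset.mem_univ, if_true]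
      simp
      ring
    have h3 : (Qᵀ * Matrix.diagonal (tot S) * Q) i j = ∑ k, Q k i * tot S k * Q k j := by
      simp [Matrix.mul_apply, Matrix.diagonal_apply]
    rw [h3, Matrix.smul_apply, Matrix.diagonal_apply, smul_eq_mul]
    rw [S.E_mul] at h
    have h4 : ∑ k, Q k i * tot S k * Q k j =
        (Fintype.card X : ℂ) ^ 2 * (if i = j then S.E i else 0).trace := by
      rw [h, mul_inv_cancel_left₀ (pow_ne_zero 2 hN)]
    rw [h4]
    split_ifs <;> simp
  have h2 : (Qᵀ * Matrix.diagonal (tot S)) *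
      (((Fintype.card X : ℂ) ^ 2)⁻¹ • (Q * Matrix.diagonal (fun i => ((S.E i).trace)⁻¹))) = 1 := by
    rw [Matrix.mul_smul, ← Matrix.mul_assoc, h1, Matrix.smul_mul, smul_smul,
      inv_mul_cancel₀ (pow_ne_zero 2 hN), one_smul, Matrix.diagonal_mul_diagonal,
      ← Matrix.diagonal_one]
    congr 1
    funext i
    exact mul_inv_cancel₀ (trace_E_pos S i).ne'
  have h3 := mul_eq_one_comm.1 h2
  rw [← h3, Matrix.smul_mul, smul_smul, mul_inv_cancel₀ (pow_ne_zero 2 hN), one_smul]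
  simp only [Matrix.mul_assoc]

lemma innerDist_zero (S : Scheme X n) (Y : Finset X) (hY : 1 < Y.card) :
    innerDist S Y 0 = 1 := by
  have : (Y.card : ℂ) ≠ 0 := by
    have : Y.card ≠ 0 := by omega
    exact_mod_cast this
  simp [innerDist, S.A_zero, Matrix.one_apply, this]

lemma macT_zero [Nonempty X] (S : Scheme X n) (Q : Matrix (Fin (n + 1)) (Fin (n + 1)) ℂ)
    (hQ : S.IsQ Q) (Y : Finset X) (hY : 1 < Y.card) :
    macT Q (innerDist S Y) 0 = Y.card := by
  have hN : (Fintype.card X : ℂ) ≠ 0 := by simp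
  have : (Y.card : ℂ) ≠ 0 := by
    have : Y.card ≠ 0 := by omega
    exact_mod_cast this
  rw [macT_eq S Q hQ, S.E_zero]
  simp
  field_simp

lemma macT_nonneg [Nonempty X] (S : Scheme X n) (Q : Matrix (Fin (n + 1)) (Fin (n + 1)) ℂ)
    (hQ : S.IsQ Q) (Y : Finset X) (i : Fin (n + 1)) :
    0 ≤ macT Q (innerDist S Y) i := by
  rw [macT_eq S Q hQ]
  have h1 : (0 : ℂ) ≤ (Fintype.card X : ℂ) := Nat.cast_nonneg _
  have h2 : (0 : ℂ) ≤ (Y.card : ℂ)⁻¹ := by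
    have : (0 : ℂ) ≤ (((Y.card : ℝ)⁻¹ : ℝ) : ℂ) := by
      rw [Complex.zero_le_real]; positivity
    simpa using this
  exact mul_nonneg (mul_nonneg h1 h2) (sum_E_nonneg S i Y)

/-- The key identity. -/
lemma key [Nonempty X] (S : Scheme X n) (hsym : S.IsSym)
    (Q : Matrix (Fin (n + 1)) (Fin (n + 1)) ℂ) (hQ : S.IsQ Q) (a b : Fin (n + 1) → ℂ)
    (ha : a 0 = 1) (hb : b 0 = 1) (hab : ∀ k, k ≠ 0 → a k * b k = 0) :
    ∑ i, macT Q a i * macT Q b i * ((S.E i).trace)⁻¹ = Fintype.card X := by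
  have hN : (Fintype.card X : ℂ) ≠ 0 := by simp
  set W := Q * Matrix.diagonal (fun i => ((S.E i).trace)⁻¹) * Qᵀ with hW
  have hWS : ∀ k l, W k l * tot S l = if k = l then (Fintype.card X : ℂ) ^ 2 else 0 := by
    intro k l
    have := congrFun (congrFun (orth S hsym Q hQ) k) l
    rw [Matrix.mul_diagonal] at this
    rw [this]
    simp [Matrix.one_apply]
  have htot : ∀ l, tot S l ≠ 0 := by
    intro l h
    have := hWS l l
    rw [h, if_pos rfl, mul_zero] at this
    exact pow_ne_zero 2 hN this.symm
  have hoff : ∀ k l, k ≠ l → W k l = 0 := by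
    intro k l h
    have := hWS k l
    rw [if_neg h] at this
    exact (mul_eq_zero.1 this).resolve_right (htot l)
  have ht0 : tot S 0 = Fintype.card X := by
    simp [tot, S.A_zero, Matrix.one_apply]
  have hW0 : W 0 0 = Fintype.card X := by
    have := hWS 0 0
    rw [if_pos rfl, ht0, sq] at this
    exact mul_right_cancel₀ hN this
  have hWe : ∀ k l, W k l = ∑ i, Q k i * ((S.E i).trace)⁻¹ * Q l i := by
    intro k l
    simp [hW, Matrix.mul_apply, Matrix.diagonal_apply]
  have h1 : ∑ i, macT Q a i * macT Q b i * ((S.E i).trace)⁻¹ = ∑ k, ∑ l, a k * b l * W k l := by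
    simp only [hWe, macT, Finset.mul_sum, Finset.sum_mul]
    have e : ∀ k : Fin (n + 1), ∑ l, ∑ i, a k * b l * (Q k i * ((S.E i).trace)⁻¹ * Q l i) =
        ∑ i, ∑ l, a k * b l * (Q k i * ((S.E i).trace)⁻¹ * Q l i) := fun k => Finset.sum_comm
    simp only [e]
    conv_rhs => rw [Finset.sum_comm]
    refine Finset.sum_congr rfl fun i _ => ?_
    rw [Finset.sum_comm]
    refine Finset.sum_congr rfl fun k _ => Finset.sum_congr rfl fun l _ => ?_
    ring
  rw [h1, Finset.sum_eq_single 0, Finset.sum_eq_single 0, ha, hb, hW0]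
  · ring
  · intro l _ hl
    rw [hoff 0 l hl.symm, mul_zero]
  · simp
  · intro k _ hk
    refine Finset.sum_eq_zero fun l _ => ?_
    by_cases h : k = l
    · subst h
      rw [hab k hk, zero_mul]
    · rw [hoff k l h, mul_zero]
  · simp

lemma trace_E_zero [Nonempty X] (S : Scheme X n) : (S.E 0).trace = 1 := by
  have hN : (Fintype.card X : ℂ) ≠ 0 := by simp
  rw [S.E_zero]
  simp [Matrix.trace, hN]

end Helpers

/-- Anticode bound: if `Y` is a `T`-code and `Z` is a `U`-code with
`T ∪ U = {1,…,n}`, then `|Y|·|Z| ≤ |X|`, with equality iff `(aQ)_i (bQ)_i = 0` for all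
`1 ≤ i ≤ n`. -/
theorem anticode_bound {X : Type*} [Fintype X] [DecidableEq X] [Nonempty X]
    {n : ℕ} (hn : 1 ≤ n) (S : Scheme X n) (hsym : S.IsSym)
    (Q : Matrix (Fin (n + 1)) (Fin (n + 1)) ℂ) (hQ : S.IsQ Q)
    (T U : Finset (Fin (n + 1))) (hTU : T ∪ U = Finset.univ.erase 0)
    (Y Z : Finset X)
    (hY1 : 1 < Y.card) (hY2 : Y.card < Fintype.card X)
    (hZ1 : 1 < Z.card) (hZ2 : Z.card < Fintype.card X)
    (hYcode : ∀ i ∈ T, innerDist S Y i = 0)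
    (hZcode : ∀ i ∈ U, innerDist S Z i = 0) :
    Y.card * Z.card ≤ Fintype.card X ∧
      (Y.card * Z.card = Fintype.card X ↔
        ∀ i : Fin (n + 1), i ≠ 0 →
          macT Q (innerDist S Y) i * macT Q (innerDist S Z) i = 0) := by
  set f : Fin (n + 1) → ℂ := fun i =>
    macT Q (innerDist S Y) i * macT Q (innerDist S Z) i * ((S.E i).trace)⁻¹ with hf
  have hinv : ∀ i, 0 < ((S.E i).trace)⁻¹ := fun i => by
    have h := trace_E_pos S i
    rw [Complex.lt_def] at h
    have hr : (S.E i).trace = (((S.E i).trace.re : ℝ) : ℂ) :=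
      Complex.ext (by simp) (by simpa using h.2.symm)
    rw [hr, ← Complex.ofReal_inv, Complex.zero_lt_real]
    exact inv_pos.2 (by simpa using h.1)
  have hf0 : ∀ i, 0 ≤ f i := fun i =>
    mul_nonneg (mul_nonneg (macT_nonneg S Q hQ Y i) (macT_nonneg S Q hQ Z i)) (hinv i).le
  have hkey : ∑ i, f i = Fintype.card X := by
    refine key S hsym Q hQ _ _ (innerDist_zero S Y hY1) (innerDist_zero S Z hZ1) ?_
    intro k hk
    have : k ∈ T ∪ U := by rw [hTU]; simp [hk]
    rcases Finset.mem_union.1 this with h | h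
    · rw [hYcode k h, zero_mul]
    · rw [hZcode k h, mul_zero]
  have hfz : f 0 = (Y.card : ℂ) * Z.card := by
    simp only [hf, macT_zero S Q hQ Y hY1, macT_zero S Q hQ Z hZ1, trace_E_zero S]
    simp
  rw [← Finset.add_sum_erase _ _ (Finset.mem_univ (0 : Fin (n + 1))), hfz] at hkey
  have hrest : 0 ≤ ∑ i ∈ Finset.univ.erase 0, f i := Finset.sum_nonneg fun i _ => hf0 i
  constructor
  · have : (Y.card : ℂ) * Z.card ≤ Fintype.card X := by
      rw [← hkey]; exact le_add_of_nonneg_right hrest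
    exact_mod_cast this
  · have h1 : Y.card * Z.card = Fintype.card X ↔ ∑ i ∈ Finset.univ.erase 0, f i = 0 := by
      constructor
      · intro h
        have h' : (Y.card : ℂ) * Z.card = Fintype.card X := by exact_mod_cast h
        rw [h'] at hkey
        simpa using hkey
      · intro h
        rw [h, add_zero] at hkey
        exact_mod_cast hkey
    rw [h1, Finset.sum_eq_zero_iff_of_nonneg fun i _ => hf0 i]
    constructor
    · intro h i hi
      have := h i (by simp [hi])
      exact (mul_eq_zero.1 this).resolve_right (hinv i).ne'
    · intro h i hi
      simp only [hf]
      rw [h i (Finset.ne_of_mem_erase hi), zero_mul]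

end AssocScheme
end

section
/- Let (X, R) be a symmetric association scheme with n classes that is metric with respect to the ordering A_0, …, A_n, and let Y ⊆ X with 1 < |Y| < |X|, with minimum distance δ and dual degree s*. If δ ≥ 2s* − 1, then Y is completely regular. -/
open Matrix BigOperators
open scoped ComplexOrder

namespace AssocScheme

section helpers

variable {X : Type*} [Fintype X] [DecidableEq X] {n : ℕ}

lemma A_nonneg (S : Scheme X n) (i : Fin (n+1)) (x y : X) : 0 ≤ S.A i x y := by
  rcases S.A_zeroOne i x y with h | h <;> rw [h]
  exact zero_le_one

lemma A_unique (S : Scheme X n) {i j : Fin (n+1)} {x y : X} (hi : S.A i x y ≠ 0)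
    (hj : S.A j x y ≠ 0) : i = j := by
  by_contra hij
  have hi1 := (S.A_zeroOne i x y).resolve_left hi
  have hj1 := (S.A_zeroOne j x y).resolve_left hj
  have h := congrFun (congrFun S.A_sum x) y
  rw [Matrix.sum_apply, ← Finset.add_sum_erase _ _ (Finset.mem_univ i), hi1] at h
  have h2 : ∑ k ∈ Finset.univ.erase i, S.A k x y = 0 := by
    simpa using h
  rw [Finset.sum_eq_zero_iff_of_nonneg (fun k _ => A_nonneg S k x y)] at h2
  exact hj (h2 j (by simp [Ne.symm hij]))

lemma outer_ne (S : Scheme X n) (Y : Finset X) (x : X) (i : Fin (n+1))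
    (h : outerB S Y x i ≠ 0) : ∃ y ∈ Y, S.A i x y ≠ 0 :=
  Finset.exists_ne_zero_of_sum_ne_zero h

lemma triangle (S : Scheme X n) (hsym : S.IsSym) (hmet : S.Metric) {j k : Fin (n+1)} {x y y' : X}
    (hj : S.A j x y ≠ 0) (hk : S.A k x y' ≠ 0) :
    ∃ l : Fin (n+1), (l : ℕ) ≤ j + k ∧ S.A l y y' ≠ 0 := by
  have h1 : (S.A j * S.A k) y y' ≠ 0 := by
    intro h0
    rw [Matrix.mul_apply, Finset.sum_eq_zero_iff_of_nonneg
      (fun z _ => mul_nonneg (A_nonneg S j y z) (A_nonneg S k z y'))] at h0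
    have h2 := h0 x (Finset.mem_univ x)
    have h3 : S.A j y x = S.A j x y := congrFun (congrFun (hsym j) x) y
    rw [h3] at h2
    exact (mul_ne_zero hj hk) h2
  rw [S.A_mul, Matrix.sum_apply] at h1
  obtain ⟨l, -, hl⟩ := Finset.exists_ne_zero_of_sum_ne_zero h1
  rw [Matrix.smul_apply, smul_eq_mul] at hl
  refine ⟨l, ?_, right_ne_zero_of_mul hl⟩
  by_contra hlt
  exact left_ne_zero_of_mul hl ((hmet j k l).1 (by omega))

lemma innerDist_ne (S : Scheme X n) (Y : Finset X) {y y' : X} (hy : y ∈ Y) (hy' : y' ∈ Y)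
    {l : Fin (n+1)} (h : S.A l y y' ≠ 0) : innerDist S Y l ≠ 0 := by
  unfold innerDist
  apply mul_ne_zero
  · simp only [ne_eq, inv_eq_zero, Nat.cast_eq_zero, Finset.card_eq_zero]
    rintro rfl
    simp at hy
  · intro h0
    rw [Finset.sum_eq_zero_iff_of_nonneg
      (fun z _ => Finset.sum_nonneg fun w _ => A_nonneg S l z w)] at h0
    have h1 := h0 y hy
    rw [Finset.sum_eq_zero_iff_of_nonneg (fun w _ => A_nonneg S l y w)] at h1
    exact h (h1 y' hy')

lemma codeword_unique (S : Scheme X n) (hsym : S.IsSym) (hmet : S.Metric) (Y : Finset X)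
    (δ : Fin (n + 1))
    (hδ : IsLeast {i : Fin (n + 1) | i ≠ 0 ∧ innerDist S Y i ≠ 0} δ)
    {j k : Fin (n+1)} (hjk : (j : ℕ) + k < δ) {x y y' : X} (hy : y ∈ Y) (hy' : y' ∈ Y)
    (hj : S.A j x y ≠ 0) (hk : S.A k x y' ≠ 0) : y = y' := by
  obtain ⟨l, hl, h⟩ := triangle S hsym hmet hj hk
  by_cases hl0 : l = 0
  · subst hl0
    rw [S.A_zero] at h
    by_contra hne
    exact h (Matrix.one_apply_ne hne)
  · have : δ ≤ l := hδ.2 ⟨hl0, innerDist_ne S Y hy hy' h⟩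
    have : (δ : ℕ) ≤ l := this
    omega

open scoped Fin.NatCast in
lemma row_det (S : Scheme X n) (hsym : S.IsSym) (hmet : S.Metric) (Y : Finset X)
    (hY : Y.Nonempty) (δ : Fin (n + 1))
    (hδ : IsLeast {i : Fin (n + 1) | i ≠ 0 ∧ innerDist S Y i ≠ 0} δ) (s : ℕ)
    (hs : 2 * s - 1 ≤ (δ : ℕ)) (x : X) (k : Fin (n+1)) (hk : (k : ℕ) < s) :
    outerB S Y x k =
      if (k : ℕ) = sInf {j : ℕ | outerB S Y x (j : Fin (n + 1)) ≠ 0} then 1 else 0 := by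
  have hne : {j : ℕ | outerB S Y x (j : Fin (n + 1)) ≠ 0}.Nonempty := by
    by_contra hemp
    rw [Set.not_nonempty_iff_eq_empty] at hemp
    obtain ⟨y, hy⟩ := hY
    have h := congrFun (congrFun S.A_sum x) y
    rw [Matrix.sum_apply] at h
    have h1 : ∑ i, S.A i x y ≠ 0 := by rw [h]; simp
    obtain ⟨i, -, hi⟩ := Finset.exists_ne_zero_of_sum_ne_zero h1
    have : (i : ℕ) ∈ {j : ℕ | outerB S Y x (j : Fin (n + 1)) ≠ 0} := by
      simp only [Set.mem_ofPred_eq, Fin.cast_val_eq_self]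
      intro h0
      unfold outerB at h0
      rw [Finset.sum_eq_zero_iff_of_nonneg (fun w _ => A_nonneg S i x w)] at h0
      exact hi (h0 y hy)
    rw [hemp] at this
    exact this
  have hmem := Nat.sInf_mem hne
  have hlow : ∀ j : ℕ, outerB S Y x (j : Fin (n+1)) ≠ 0 →
      sInf {j : ℕ | outerB S Y x (j : Fin (n + 1)) ≠ 0} ≤ j := fun j hj => Nat.sInf_le hj
  generalize sInf {j : ℕ | outerB S Y x (j : Fin (n + 1)) ≠ 0} = m at hmem hlow
  simp only [Set.mem_ofPred_eq] at hmem
  split_ifs with hkm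
  · subst hkm
    rw [Fin.cast_val_eq_self] at hmem
    obtain ⟨y, hy, hA⟩ := outer_ne S Y x k hmem
    unfold outerB
    rw [Finset.sum_eq_single y]
    · exact (S.A_zeroOne k x y).resolve_left hA
    · intro y' hy' hne'
      by_contra hA'
      exact hne' (codeword_unique S hsym hmet Y δ hδ (by omega) hy' hy hA' hA)
    · exact fun h => absurd hy h
  · by_contra hB
    have hle := hlow k (by rwa [Fin.cast_val_eq_self])
    obtain ⟨y, hy, hA⟩ := outer_ne S Y x k hB
    obtain ⟨y', hy', hA'⟩ := outer_ne S Y x _ hmem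
    have hm : ((m : Fin (n+1)) : ℕ) = m := Fin.val_cast_of_lt (by omega)
    have := codeword_unique S hsym hmet Y δ hδ (by omega) hy hy' hA hA'
    subst this
    have := A_unique S hA hA'
    apply hkm
    rw [this, hm]

/-- The characteristic vector. -/
noncomputable def chi (Y : Finset X) : X → ℂ := fun x => if x ∈ Y then 1 else 0

lemma mulVec_chi (M : Matrix X X ℂ) (Y : Finset X) (x : X) :
    (M *ᵥ chi Y) x = ∑ y ∈ Y, M x y := by
  simp [Matrix.mulVec, dotProduct, chi]

lemma E_chi_zero [Nonempty X] (S : Scheme X n) (Q : Matrix (Fin (n + 1)) (Fin (n + 1)) ℂ)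
    (hQ : S.IsQ Q) (Y : Finset X) (hY : Y.Nonempty) (i : Fin (n+1))
    (h : macT Q (innerDist S Y) i = 0) : S.E i *ᵥ chi Y = 0 := by
  have hX : (Fintype.card X : ℂ) ≠ 0 := by simp
  have hYc : (Y.card : ℂ) ≠ 0 := by simpa using hY.ne_empty
  have h1 : ∑ x ∈ Y, ∑ y ∈ Y, S.E i x y = 0 := by
    have e : ∀ x y, S.E i x y = (Fintype.card X : ℂ)⁻¹ * ∑ j, Q j i * S.A j x y := by
      intro x y
      rw [hQ i]
      simp [Matrix.sum_apply]
    simp only [e, ← Finset.mul_sum]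
    have : macT Q (innerDist S Y) i
        = (Y.card : ℂ)⁻¹ * ∑ x ∈ Y, ∑ y ∈ Y, ∑ j, Q j i * S.A j x y := by
      unfold macT innerDist
      have e2 : ∀ x, ∑ y ∈ Y, ∑ j, Q j i * S.A j x y = ∑ j, ∑ y ∈ Y, Q j i * S.A j x y :=
        fun x => Finset.sum_comm
      simp only [e2]
      rw [Finset.sum_comm, Finset.mul_sum]
      refine Finset.sum_congr rfl fun j _ => ?_
      simp only [← Finset.mul_sum]
      ring
    rw [this] at h
    rw [(mul_eq_zero.mp h).resolve_left (inv_ne_zero hYc), mul_zero]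
  rw [← dotProduct_star_self_eq_zero, ← h1]
  have hs : star (chi Y) = chi Y := by
    ext x
    simp only [chi, Pi.star_apply]
    split_ifs <;> simp
  rw [Matrix.star_mulVec, hs, (S.E_herm i).eq, Matrix.dotProduct_mulVec,
    Matrix.vecMul_vecMul, S.E_mul, if_pos rfl, ← Matrix.dotProduct_mulVec]
  simp [dotProduct, mulVec_chi, chi]

open Polynomial in
lemma aeval_mul_E (S : Scheme X n) (P : Matrix (Fin (n + 1)) (Fin (n + 1)) ℂ) (hP : S.IsP P)
    (a i : Fin (n+1)) (f : ℂ[X]) : aeval (S.A a) f * S.E i = f.eval (P i a) • S.E i := by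
  have hA : S.A a * S.E i = P i a • S.E i := by
    rw [hP a, Finset.sum_mul]
    simp [S.E_mul]
  induction f using Polynomial.induction_on' with
  | add p q hp hq => simp [add_mul, hp, hq, add_smul]
  | monomial k c =>
    rw [Polynomial.aeval_monomial, Polynomial.eval_monomial, mul_assoc, mul_smul,
      ← Algebra.smul_def]
    congr 1
    induction k with
    | zero => simp
    | succ k ih => rw [pow_succ, mul_assoc, hA, mul_smul_comm, ih, smul_smul, pow_succ, mul_comm]

open Polynomial in
lemma pow_mem (S : Scheme X n) (hmet : S.Metric) (a : Fin (n+1)) (ha : (a : ℕ) = 1) (k : ℕ) :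
    S.A a ^ k ∈ Submodule.span ℂ (S.A '' {i | (i : ℕ) ≤ k}) := by
  induction k with
  | zero =>
    rw [pow_zero, ← S.A_zero]
    exact Submodule.subset_span ⟨0, by simp, rfl⟩
  | succ k ih =>
    rw [pow_succ']
    refine Submodule.span_induction (p := fun M _ => S.A a * M ∈
      Submodule.span ℂ (S.A '' {i | (i : ℕ) ≤ k + 1})) ?_ ?_ ?_ ?_ ih
    · rintro _ ⟨j, hj, rfl⟩
      rw [S.A_mul]
      refine Submodule.sum_mem _ fun l _ => ?_
      by_cases hl : (l : ℕ) ≤ k + 1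
      · exact Submodule.smul_mem _ _ (Submodule.subset_span ⟨l, hl, rfl⟩)
      · have hj' : (j : ℕ) ≤ k := hj
        rw [(hmet a j l).1 (by omega), zero_smul]
        exact Submodule.zero_mem _
    · simp
    · intro x y _ _ hx hy
      rw [mul_add]
      exact Submodule.add_mem _ hx hy
    · intro c x _ hx
      rw [mul_smul_comm]
      exact Submodule.smul_mem _ _ hx

open Polynomial in
lemma A_poly (S : Scheme X n) (hmet : S.Metric) (a : Fin (n+1)) (ha : (a : ℕ) = 1) (m : ℕ) :
    ∀ i : Fin (n+1), (i : ℕ) = m → ∃ f : ℂ[X], aeval (S.A a) f = S.A i := by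
  induction m using Nat.strong_induction_on with
  | _ m ih =>
    intro i hi
    rcases m with _ | m
    · refine ⟨1, ?_⟩
      have : i = 0 := Fin.ext hi
      rw [this, S.A_zero, map_one]
    · let j : Fin (n+1) := ⟨m, by omega⟩
      have hj : (j : ℕ) = m := rfl
      have hp : S.p a j i ≠ 0 := (hmet a j i).2 (by omega)
      have hmul := S.A_mul a j
      rw [← Finset.add_sum_erase _ _ (Finset.mem_univ i)] at hmul
      have hmem : ∀ M : Matrix X X ℂ, M ∈ (aeval (R := ℂ) (S.A a)).range ↔
          ∃ f : ℂ[X], aeval (S.A a) f = M := fun M => AlgHom.mem_range _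
      rw [← hmem]
      have h1 : ∑ k ∈ Finset.univ.erase i, S.p a j k • S.A k ∈ (aeval (R := ℂ) (S.A a)).range := by
        refine Subalgebra.sum_mem _ fun k hk => ?_
        have hki : k ≠ i := Finset.ne_of_mem_erase hk
        have hki' : (k : ℕ) ≠ i := fun h => hki (Fin.ext h)
        by_cases hkm : (k : ℕ) < m + 1
        · exact Subalgebra.smul_mem _ ((hmem _).2 (ih k hkm k rfl)) _
        · rw [(hmet a j k).1 (by omega), zero_smul]
          exact Subalgebra.zero_mem _
      have h2 : S.A a * S.A j ∈ (aeval (R := ℂ) (S.A a)).range :=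
        Subalgebra.mul_mem _ ((hmem _).2 ⟨Polynomial.X, by simp⟩)
          ((hmem _).2 (ih m (by omega) j rfl))
      have h3 : S.A i = (S.p a j i)⁻¹ • (S.A a * S.A j
          - ∑ k ∈ Finset.univ.erase i, S.p a j k • S.A k) := by
        rw [hmul, add_sub_cancel_right, smul_smul, inv_mul_cancel₀ hp, one_smul]
      rw [h3]
      exact Subalgebra.smul_mem _ (Subalgebra.sub_mem _ h2 h1) _

open Polynomial in
lemma rows_eq [Nonempty X] (S : Scheme X n) (hmet : S.Metric) (hn : 1 ≤ n)
    (P Q : Matrix (Fin (n + 1)) (Fin (n + 1)) ℂ) (hP : S.IsP P) (hQ : S.IsQ Q)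
    (Y : Finset X) (hY : Y.Nonempty) (T : Finset (Fin (n+1)))
    (hT : ∀ i, i ≠ 0 → macT Q (innerDist S Y) i ≠ 0 → i ∈ T) (x x' : X)
    (h : ∀ k : Fin (n+1), (k : ℕ) < T.card → outerB S Y x k = outerB S Y x' k)
    (i : Fin (n+1)) : outerB S Y x i = outerB S Y x' i := by
  have hB : ∀ z k, outerB S Y z k = (S.A k *ᵥ chi Y) z := fun z k => (mulVec_chi _ _ _).symm
  simp only [hB] at h ⊢
  let a : Fin (n+1) := ⟨1, by omega⟩
  have ha : (a : ℕ) = 1 := rfl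
  let F : ℂ[X] := ∏ t ∈ T, (Polynomial.X - C (P t a))
  have hFm : F.Monic := monic_prod_of_monic _ _ fun t _ => monic_X_sub_C _
  have hFd : F.natDegree = T.card := by
    simp [F, natDegree_prod_of_monic _ _ fun t _ => monic_X_sub_C (P t a)]
  obtain ⟨v, hv⟩ := A_poly S hmet a ha i i rfl
  -- the part which is divisible by `F` gives a constant vector
  have hF : aeval (S.A a) (F * (v /ₘ F)) *ᵥ chi Y
      = (F * (v /ₘ F)).eval (P 0 a) • (S.E 0 *ᵥ chi Y) := by
    have e : aeval (S.A a) (F * (v /ₘ F))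
        = ∑ j, (F * (v /ₘ F)).eval (P j a) • S.E j := by
      rw [← mul_one (aeval (S.A a) (F * (v /ₘ F))), ← S.E_sum, Finset.mul_sum]
      exact Finset.sum_congr rfl fun j _ => aeval_mul_E S P hP a j _
    rw [e, Matrix.sum_mulVec, Finset.sum_eq_single 0]
    · rw [Matrix.smul_mulVec]
    · intro j _ hj
      rw [Matrix.smul_mulVec]
      by_cases hm : macT Q (innerDist S Y) j = 0
      · rw [E_chi_zero S Q hQ Y hY j hm, smul_zero]
      · have : F.eval (P j a) = 0 := by
          rw [Polynomial.eval_prod]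
          exact Finset.prod_eq_zero (hT j hj hm) (by simp)
        rw [Polynomial.eval_mul, this, zero_mul, zero_smul]
    · simp
  have hr : ∀ r : ℂ[X], r.degree < (T.card : ℕ) →
      (aeval (S.A a) r *ᵥ chi Y) x = (aeval (S.A a) r *ᵥ chi Y) x' := by
    intro r hr
    rw [aeval_eq_sum_range, Matrix.sum_mulVec, Finset.sum_apply, Finset.sum_apply]
    refine Finset.sum_congr rfl fun k hk => ?_
    rw [Matrix.smul_mulVec, Pi.smul_apply, Pi.smul_apply]
    by_cases hck : r.coeff k = 0
    · simp [hck]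
    have hkT : k < T.card := by
      have := (le_degree_of_ne_zero hck).trans_lt hr
      exact_mod_cast this
    congr 1
    refine Submodule.span_induction (p := fun M _ => (M *ᵥ chi Y) x = (M *ᵥ chi Y) x')
      ?_ ?_ ?_ ?_ (pow_mem S hmet a ha k)
    · rintro _ ⟨l, hl, rfl⟩
      exact h l (lt_of_le_of_lt hl hkT)
    · simp
    · intro M N _ _ hM hN
      simp only [Matrix.add_mulVec, Pi.add_apply, hM, hN]
    · intro c M _ hM
      simp only [Matrix.smul_mulVec, Pi.smul_apply, hM]
  have hdeg : (v %ₘ F).degree < (T.card : ℕ) := by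
    have := degree_modByMonic_lt v hFm
    rwa [degree_eq_natDegree hFm.ne_zero, hFd] at this
  have hconst : (S.E 0 *ᵥ chi Y) x = (S.E 0 *ᵥ chi Y) x' := by
    simp [mulVec_chi, S.E_zero]
  rw [← hv, ← modByMonic_add_div v F, map_add, Matrix.add_mulVec, hF, Pi.add_apply, Pi.add_apply,
    hr _ hdeg, Pi.smul_apply, Pi.smul_apply, hconst]

end helpers

/-- in a metric scheme, a code with `δ ≥ 2s* − 1` is completely regular. -/
theorem delta_ge_implies_completely_regular {X : Type*} [Fintype X] [DecidableEq X]
    [Nonempty X] {n : ℕ} (hn : 1 ≤ n) (S : Scheme X n) (hsym : S.IsSym) (hmet : S.Metric)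
    (P Q : Matrix (Fin (n + 1)) (Fin (n + 1)) ℂ) (hP : S.IsP P) (hQ : S.IsQ Q)
    (Y : Finset X) (hY1 : 1 < Y.card) (hY2 : Y.card < Fintype.card X)
    (δ : Fin (n + 1))
    (hδ : IsLeast {i : Fin (n + 1) | i ≠ 0 ∧ innerDist S Y i ≠ 0} δ)
    (hge : 2 * Nat.card {i : Fin (n + 1) | i ≠ 0 ∧ macT Q (innerDist S Y) i ≠ 0} - 1
      ≤ (δ : ℕ)) :
    CompletelyRegular S Y := by
  classical
  have hY : Y.Nonempty := Finset.card_pos.mp (by omega)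
  let T : Finset (Fin (n+1)) :=
    Finset.univ.filter fun i => i ≠ 0 ∧ macT Q (innerDist S Y) i ≠ 0
  have hT : Nat.card {i : Fin (n + 1) | i ≠ 0 ∧ macT Q (innerDist S Y) i ≠ 0} = T.card := by
    rw [← Nat.card_eq_finsetCard T]
    exact Nat.card_congr (Equiv.subtypeEquivRight fun i => by simp [T])
  rw [hT] at hge
  intro x x' hxx i
  refine rows_eq S hmet hn P Q hP hQ Y hY T (fun j h0 h1 => by simp [T, h0, h1]) x x' ?_ i
  intro k hk
  rw [row_det S hsym hmet Y hY δ hδ T.card hge x k hk,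
    row_det S hsym hmet Y hY δ hδ T.card hge x' k hk, hxx]

end AssocScheme
end

section
/- Let (X, R) be a symmetric association scheme with n classes that is metric with respect to the ordering A_0, …, A_n, and let Y ⊆ X with 1 < |Y| < |X|, with minimum distance δ and dual degree s*. If δ ≥ s*, then Y is regular. -/
open Matrix BigOperators
open scoped ComplexOrder

namespace AssocScheme

/-- Matrices `M` such that `M χ` is constant on `Y`. -/
def constOn {X : Type*} (Y : Finset X) : Submodule ℂ (Matrix X X ℂ) where
  carrier := {M | ∃ c : ℂ, ∀ x ∈ Y, ∑ y ∈ Y, M x y = c}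
  zero_mem' := ⟨0, by simp⟩
  add_mem' := by
    rintro M N ⟨c, hc⟩ ⟨d, hd⟩
    refine ⟨c + d, fun x hx => ?_⟩
    simp [Finset.sum_add_distrib, hc x hx, hd x hx]
  smul_mem' := by
    rintro a M ⟨c, hc⟩
    refine ⟨a * c, fun x hx => ?_⟩
    simp [← Finset.mul_sum, hc x hx]

lemma herm_zero {X : Type*} [Fintype X] [DecidableEq X] (M : Matrix X X ℂ)
    (hM : M.IsHermitian) (hM2 : M * M = M) (Y : Finset X)
    (h : ∑ x ∈ Y, ∑ y ∈ Y, M x y = 0) (x : X) : ∑ y ∈ Y, M x y = 0 := by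
  set χ : X → ℂ := fun x => if x ∈ Y then 1 else 0 with hχ
  have hv : ∀ x, (M *ᵥ χ) x = ∑ y ∈ Y, M x y := by
    intro x
    simp [Matrix.mulVec, dotProduct, hχ]
  have hs : star χ = χ := by
    ext x
    by_cases hx : x ∈ Y <;> simp [hχ, hx]
  have h0 : star (M *ᵥ χ) ⬝ᵥ (M *ᵥ χ) = 0 := by
    rw [Matrix.star_mulVec, hM.eq, ← Matrix.dotProduct_mulVec, Matrix.mulVec_mulVec, hM2, hs]
    rw [← h]
    simp only [dotProduct, hv]
    simp [hχ]
  have := dotProduct_star_self_eq_zero.mp (by rwa [dotProduct_comm] at h0)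
  rw [← hv, this]; rfl

lemma gen {X : Type*} [Fintype X] [DecidableEq X] {n : ℕ} (S : Scheme X n) (hmet : S.Metric)
    (e : Fin (n + 1)) (he : (e : ℕ) = 1) (k : ℕ) :
    ∀ i : Fin (n + 1), (i : ℕ) = k → S.A i ∈ (Polynomial.aeval (R := ℂ) (S.A e)).range := by
  induction k using Nat.strong_induction_on with
  | _ k ih =>
    intro i hi
    rcases k with _ | k
    · have : i = 0 := Fin.ext hi
      rw [this, S.A_zero]
      exact one_mem _
    · have hk : k < n + 1 := by omega
      have h1 := S.A_mul e ⟨k, hk⟩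
      rw [← Finset.add_sum_erase _ _ (Finset.mem_univ i)] at h1
      have hp : S.p e ⟨k, hk⟩ i ≠ 0 := (hmet e ⟨k, hk⟩ i).2 (by simp; omega)
      have h2 : S.p e ⟨k, hk⟩ i • S.A i ∈ (Polynomial.aeval (R := ℂ) (S.A e)).range := by
        rw [eq_sub_of_add_eq h1.symm]
        refine sub_mem (mul_mem ⟨Polynomial.X, by simp⟩ (ih k (by omega) _ rfl)) ?_
        refine sum_mem fun j hj => ?_
        by_cases hjk : (j : ℕ) < k + 1
        · exact Subalgebra.smul_mem _ (ih j hjk j rfl) _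
        · have hne : (j : ℕ) ≠ k + 1 := fun h =>
            (Finset.mem_erase.mp hj).1 (Fin.ext (by omega))
          rw [(hmet e ⟨k, hk⟩ j).1 (by simp; omega), zero_smul]
          exact zero_mem _
      have h3 := Subalgebra.smul_mem _ h2 (S.p e ⟨k, hk⟩ i)⁻¹
      rwa [smul_smul, inv_mul_cancel₀ hp, one_smul] at h3

lemma A_pow_mem {X : Type*} [Fintype X] [DecidableEq X] {n : ℕ} (S : Scheme X n) (hmet : S.Metric)
    (e : Fin (n + 1)) (he : (e : ℕ) = 1) (k : ℕ) :
    S.A e ^ k ∈ Submodule.span ℂ (S.A '' {i | (i : ℕ) ≤ k}) := by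
  induction k with
  | zero =>
    rw [pow_zero, ← S.A_zero]
    exact Submodule.subset_span ⟨0, by simp, rfl⟩
  | succ k ih =>
    rw [pow_succ']
    have : Submodule.span ℂ (S.A '' {i | (i : ℕ) ≤ k}) ≤
        (Submodule.span ℂ (S.A '' {i | (i : ℕ) ≤ k + 1})).comap (LinearMap.mulLeft ℂ (S.A e)) := by
      rw [Submodule.span_le]
      rintro _ ⟨i, hi, rfl⟩
      simp only [Set.mem_setOf_eq] at hi
      simp only [Submodule.comap_coe, Set.mem_preimage, LinearMap.mulLeft_apply, SetLike.mem_coe]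
      rw [S.A_mul]
      refine sum_mem fun j _ => ?_
      by_cases hj : (j : ℕ) ≤ k + 1
      · exact Submodule.smul_mem _ _ (Submodule.subset_span ⟨j, hj, rfl⟩)
      · rw [(hmet e i j).1 (by omega), zero_smul]
        exact zero_mem _
    exact this ih

lemma aeval_mul_E_s10 {X : Type*} [Fintype X] [DecidableEq X] {n : ℕ} (S : Scheme X n)
    (P : Matrix (Fin (n + 1)) (Fin (n + 1)) ℂ) (hP : S.IsP P) (e j : Fin (n + 1))
    (q : Polynomial ℂ) :
    Polynomial.aeval (S.A e) q * S.E j = q.eval (P j e) • S.E j := by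
  have hA : S.A e * S.E j = P j e • S.E j := by
    rw [hP e, Finset.sum_mul]
    simp [S.E_mul]
  induction q using Polynomial.induction_on' with
  | add p q hp hq => simp [add_mul, hp, hq, add_smul]
  | monomial k a =>
    have hpow : S.A e ^ k * S.E j = (P j e) ^ k • S.E j := by
      induction k with
      | zero => simp
      | succ k ih => rw [pow_succ, mul_assoc, hA, mul_smul_comm, ih, smul_smul, pow_succ, mul_comm]
    rw [Polynomial.aeval_monomial, Polynomial.eval_monomial, mul_assoc, hpow,
      ← Algebra.smul_def, smul_smul]

lemma theta_inj {X : Type*} [Fintype X] [DecidableEq X] {n : ℕ} (S : Scheme X n)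
    (hmet : S.Metric) (P : Matrix (Fin (n + 1)) (Fin (n + 1)) ℂ) (hP : S.IsP P)
    (e : Fin (n + 1)) (he : (e : ℕ) = 1) (j k : Fin (n + 1)) (h : P j e = P k e) : j = k := by
  have hmem : S.E j ∈ (Polynomial.aeval (R := ℂ) (S.A e)).range := by
    have : Submodule.span ℂ (Set.range S.A) ≤
        Subalgebra.toSubmodule (Polynomial.aeval (R := ℂ) (S.A e)).range := by
      rw [Submodule.span_le]
      rintro _ ⟨i, rfl⟩
      exact gen S hmet e he i i rfl
    exact this (S.E_span j)
  obtain ⟨q, hq⟩ := hmem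
  have hq' : Polynomial.aeval (S.A e) q = S.E j := hq
  by_contra hne
  have h1 := aeval_mul_E_s10 S P hP e j q
  have h2 := aeval_mul_E_s10 S P hP e k q
  rw [hq', S.E_mul, if_pos rfl] at h1
  rw [hq', S.E_mul, if_neg hne, ← h] at h2
  rcases smul_eq_zero.mp h2.symm with h3 | h3
  · rw [h3, zero_smul] at h1
    exact S.E_ne j h1
  · exact S.E_ne k h3

/-- in a metric scheme, a code with `δ ≥ s*` is regular. -/
theorem delta_ge_dual_degree_implies_regular {X : Type*} [Fintype X] [DecidableEq X]
    [Nonempty X] {n : ℕ} (hn : 1 ≤ n) (S : Scheme X n) (hsym : S.IsSym) (hmet : S.Metric)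
    (P Q : Matrix (Fin (n + 1)) (Fin (n + 1)) ℂ) (hP : S.IsP P) (hQ : S.IsQ Q)
    (Y : Finset X) (hY1 : 1 < Y.card) (hY2 : Y.card < Fintype.card X)
    (δ : Fin (n + 1))
    (hδ : IsLeast {i : Fin (n + 1) | i ≠ 0 ∧ innerDist S Y i ≠ 0} δ)
    (hge : Nat.card {i : Fin (n + 1) | i ≠ 0 ∧ macT Q (innerDist S Y) i ≠ 0} ≤ (δ : ℕ)) :
    Regular S Y := by
  have hYc : (Y.card : ℂ) ≠ 0 := by
    exact_mod_cast (by omega : Y.card ≠ 0)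
  have hXc : (Fintype.card X : ℂ) ≠ 0 := by
    exact_mod_cast (by omega : Fintype.card X ≠ 0)
  obtain ⟨e, he⟩ : ∃ e : Fin (n + 1), (e : ℕ) = 1 := ⟨⟨1, by omega⟩, rfl⟩
  classical
  set T : Finset (Fin (n + 1)) :=
    Finset.univ.filter fun i => i ≠ 0 ∧ macT Q (innerDist S Y) i ≠ 0 with hT
  have hTc : T.card ≤ (δ : ℕ) := by
    refine le_trans (le_of_eq ?_) hge
    rw [Nat.subtype_card T (by simp [hT])]
  -- low distance matrices
  have hlow : ∀ i : Fin (n + 1), (i : ℕ) < δ → S.A i ∈ constOn Y := by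
    intro i hi
    by_cases h0 : i = 0
    · refine ⟨1, fun x hx => ?_⟩
      rw [h0, S.A_zero]
      simp [Matrix.one_apply, hx]
    · have hz : innerDist S Y i = 0 := by
        by_contra hne
        have := hδ.2 ⟨h0, hne⟩
        exact absurd (Fin.le_def.mp this) (by omega)
      have hz' : ∑ x ∈ Y, ∑ y ∈ Y, S.A i x y = 0 := by
        rcases mul_eq_zero.mp hz with h | h
        · exact absurd h (inv_ne_zero hYc)
        · exact h
      have hnn : ∀ x y, 0 ≤ S.A i x y := by
        intro x y
        rcases S.A_zeroOne i x y with h | h <;> rw [h]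
        exact zero_le_one
      refine ⟨0, fun x hx => ?_⟩
      exact (Finset.sum_eq_zero_iff_of_nonneg
        (fun x _ => Finset.sum_nonneg fun y _ => hnn x y)).mp hz' x hx
  have hpoly : ∀ q : Polynomial ℂ, q.natDegree < δ →
      Polynomial.aeval (S.A e) q ∈ constOn Y := by
    intro q hq
    rw [Polynomial.aeval_eq_sum_range]
    refine sum_mem fun k hk => Submodule.smul_mem _ _ ?_
    have hk' : k < δ := by
      have := Finset.mem_range.mp hk
      omega
    have hle : Submodule.span ℂ (S.A '' {i | (i : ℕ) ≤ k}) ≤ constOn Y := by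
      rw [Submodule.span_le]
      rintro _ ⟨i, hi, rfl⟩
      exact hlow i (lt_of_le_of_lt hi hk')
    exact hle (A_pow_mem S hmet e he k)
  have hE0 : S.E 0 ∈ constOn Y := by
    rw [S.E_zero]
    exact Submodule.smul_mem _ _ ⟨Y.card, fun x _ => by simp⟩
  have hEz : ∀ j, j ≠ 0 → j ∉ T → ∀ x, ∑ y ∈ Y, S.E j x y = 0 := by
    intro j hj hjT
    have hm : macT Q (innerDist S Y) j = 0 := by
      by_contra hne
      exact hjT (by simp [hT, hj, hne])
    refine herm_zero _ (S.E_herm j) (by simp [S.E_mul]) Y ?_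
    have : ∑ x ∈ Y, ∑ y ∈ Y, S.E j x y =
        (Fintype.card X : ℂ)⁻¹ * ((Y.card : ℂ) * macT Q (innerDist S Y) j) := by
      rw [hQ j]
      simp only [Matrix.smul_apply, Matrix.sum_apply, smul_eq_mul, ← Finset.mul_sum, macT,
        innerDist]
      congr 1
      rw [Finset.mul_sum]
      simp_rw [Finset.sum_comm (s := Y) (t := Finset.univ)]
      refine Finset.sum_congr rfl fun i _ => ?_
      simp_rw [← Finset.mul_sum]
      field_simp
    rw [this, hm, mul_zero, mul_zero]
  have hEz' : ∀ j, j ≠ 0 → j ∉ T → S.E j ∈ constOn Y := fun j hj hjT =>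
    ⟨0, fun x _ => hEz j hj hjT x⟩
  have hET : ∀ j ∈ T, S.E j ∈ constOn Y := by
    intro j hj
    set L : Polynomial ℂ := ∏ k ∈ T.erase j, (Polynomial.X - Polynomial.C (P k e)) with hL
    have hdeg : L.natDegree < δ := by
      rw [hL, Polynomial.natDegree_finsetProd_X_sub_C_eq_card, Finset.card_erase_of_mem hj]
      have := Finset.card_pos.mpr ⟨j, hj⟩
      omega
    have hLj : L.eval (P j e) ≠ 0 := by
      rw [hL, Polynomial.eval_prod, Finset.prod_ne_zero_iff]
      intro k hk
      simp only [Polynomial.eval_sub, Polynomial.eval_X, Polynomial.eval_C]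
      intro h
      exact (Finset.mem_erase.mp hk).1 (theta_inj S hmet P hP e he j k (sub_eq_zero.mp h)).symm
    have hLk : ∀ k ∈ T, k ≠ j → L.eval (P k e) = 0 := by
      intro k hk hkj
      rw [hL, Polynomial.eval_prod]
      exact Finset.prod_eq_zero (Finset.mem_erase.mpr ⟨hkj, hk⟩) (by simp)
    have hdec : Polynomial.aeval (S.A e) L = ∑ k, L.eval (P k e) • S.E k := by
      conv_lhs => rw [← mul_one (Polynomial.aeval (S.A e) L), ← S.E_sum, Finset.mul_sum]
      exact Finset.sum_congr rfl fun k _ => aeval_mul_E_s10 S P hP e k L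
    have hmem := hpoly L hdeg
    rw [hdec, ← Finset.add_sum_erase _ _ (Finset.mem_univ j)] at hmem
    have hrest : ∑ k ∈ Finset.univ.erase j, L.eval (P k e) • S.E k ∈ constOn Y := by
      refine sum_mem fun k hk => ?_
      have hkj := (Finset.mem_erase.mp hk).1
      by_cases hk0 : k = 0
      · rw [hk0]
        exact Submodule.smul_mem _ _ hE0
      by_cases hkT : k ∈ T
      · rw [hLk k hkT hkj, zero_smul]
        exact zero_mem _
      · exact Submodule.smul_mem _ _ (hEz' k hk0 hkT)
    have h1 := (Submodule.add_mem_iff_left _ hrest).mp hmem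
    exact (Submodule.smul_mem_iff _ hLj).mp h1
  have hE : ∀ j, S.E j ∈ constOn Y := by
    intro j
    by_cases h0 : j = 0
    · rw [h0]
      exact hE0
    by_cases hjT : j ∈ T
    · exact hET j hjT
    · exact hEz' j h0 hjT
  intro x hx i
  have hA : S.A i ∈ constOn Y := by
    rw [hP i]
    exact sum_mem fun j _ => Submodule.smul_mem _ _ (hE j)
  obtain ⟨c, hc⟩ := hA
  rw [outerB, innerDist, hc x hx, Finset.sum_congr rfl hc]
  simp [hYc]

end AssocScheme
end

section
/- Let (X, R) be a symmetric association scheme with n classes that is cometric with respect to the ordering E_0, …, E_n, and let Y ⊆ X with 1 < |Y| < |X|, with dual distance δ* and degree s. If δ* ≥ s, then Y is regular. -/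
open Matrix BigOperators
open scoped ComplexOrder

namespace AssocScheme

/-- Injectivity of `Q` as a linear map: columns of `Q` are linearly independent. -/
theorem isQ_inj {X : Type*} [Fintype X] [DecidableEq X] {n : ℕ} (S : Scheme X n)
    (Q : Matrix (Fin (n + 1)) (Fin (n + 1)) ℂ) (hQ : S.IsQ Q)
    (c : Fin (n + 1) → ℂ) (hc : Q *ᵥ c = 0) : c = 0 := by
  have h0 : ∑ m, c m • S.E m = 0 := by
    have : ∀ m, c m • S.E m =
        (Fintype.card X : ℂ)⁻¹ • ∑ j, (Q j m * c m) • S.A j := by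
      intro m
      rw [hQ m, smul_comm, Finset.smul_sum]
      simp only [smul_smul, mul_comm]
    rw [Finset.sum_congr rfl (fun m _ => this m), ← Finset.smul_sum, Finset.sum_comm]
    simp only [← Finset.sum_smul]
    have h1 : ∀ j, ∑ m, Q j m * c m = 0 := fun j => congrFun hc j
    simp [h1]
  funext k
  have h2 : (∑ m, c m • S.E m) * S.E k = c k • S.E k := by
    simp [Finset.sum_mul, S.E_mul]
  rw [h0, zero_mul] at h2
  have := (smul_eq_zero.mp h2.symm).resolve_right (S.E_ne k)
  simpa using this

theorem isQ_rows {X : Type*} [Fintype X] [DecidableEq X] {n : ℕ} (S : Scheme X n)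
    (Q : Matrix (Fin (n + 1)) (Fin (n + 1)) ℂ) (hQ : S.IsQ Q)
    (i j : Fin (n + 1)) (h : ∀ m, Q i m = Q j m) : i = j := by
  by_contra hne
  have hd : Q.det = 0 := Matrix.det_zero_of_row_eq hne (funext h)
  obtain ⟨v, hv, hv'⟩ := Matrix.exists_mulVec_eq_zero_iff.mpr hd
  exact hv (isQ_inj S Q hQ v hv')

theorem A_single {X : Type*} [Fintype X] [DecidableEq X] {n : ℕ} (S : Scheme X n)
    (x y : X) (j : Fin (n + 1)) (h : S.A j x y = 1) (i : Fin (n + 1)) (hi : i ≠ j) :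
    S.A i x y = 0 := by
  rcases S.A_zeroOne i x y with h0 | h1
  · exact h0
  exfalso
  have hs : ∑ k, S.A k x y = 1 := by
    have := congrFun (congrFun S.A_sum x) y
    simpa [Matrix.sum_apply] using this
  have hre : ∑ k, (S.A k x y).re = 1 := by
    rw [← Complex.re_sum, hs]; simp
  have hnn : ∀ k, 0 ≤ (S.A k x y).re := by
    intro k
    rcases S.A_zeroOne k x y with h | h <;> simp [h]
  have h2 : ∑ k ∈ {i, j}, (S.A k x y).re ≤ ∑ k, (S.A k x y).re :=
    Finset.sum_le_sum_of_subset_of_nonneg (Finset.subset_univ _) (fun k _ _ => hnn k)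
  rw [Finset.sum_pair hi, hre, h, h1] at h2
  norm_num at h2

theorem E_apply {X : Type*} [Fintype X] [DecidableEq X] [Nonempty X] {n : ℕ} (S : Scheme X n)
    (Q : Matrix (Fin (n + 1)) (Fin (n + 1)) ℂ) (hQ : S.IsQ Q)
    (x y : X) (m : Fin (n + 1)) :
    (Fintype.card X : ℂ) * S.E m x y = ∑ j, Q j m * S.A j x y := by
  have hX : (Fintype.card X : ℂ) ≠ 0 := by exact_mod_cast Fintype.card_ne_zero
  rw [hQ m]
  simp only [Matrix.smul_apply, Matrix.sum_apply, smul_eq_mul]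
  rw [mul_inv_cancel_left₀ hX]

theorem Q_eq {X : Type*} [Fintype X] [DecidableEq X] [Nonempty X] {n : ℕ} (S : Scheme X n)
    (Q : Matrix (Fin (n + 1)) (Fin (n + 1)) ℂ) (hQ : S.IsQ Q)
    (x y : X) (j : Fin (n + 1)) (h : S.A j x y = 1) (m : Fin (n + 1)) :
    Q j m = (Fintype.card X : ℂ) * S.E m x y := by
  rw [E_apply S Q hQ, Finset.sum_eq_single j]
  · simp [h]
  · intro b _ hb
    rw [A_single S x y j h b hb, mul_zero]
  · simp

theorem Q_krein {X : Type*} [Fintype X] [DecidableEq X] [Nonempty X] {n : ℕ} (S : Scheme X n)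
    (Q : Matrix (Fin (n + 1)) (Fin (n + 1)) ℂ) (hQ : S.IsQ Q)
    (q : Fin (n + 1) → Fin (n + 1) → Fin (n + 1) → ℂ) (hq : S.IsKrein q)
    (x y : X) (j : Fin (n + 1)) (h : S.A j x y = 1) (l m : Fin (n + 1)) :
    Q j l * Q j m = ∑ k, q l m k * Q j k := by
  have hX : (Fintype.card X : ℂ) ≠ 0 := by exact_mod_cast Fintype.card_ne_zero
  have hk := congrFun (congrFun (hq l m) x) y
  simp only [Matrix.hadamard_apply, Matrix.smul_apply, Matrix.sum_apply, smul_eq_mul] at hk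
  simp only [Q_eq S Q hQ x y j h]
  calc _ = (Fintype.card X : ℂ) * (Fintype.card X : ℂ) * (S.E l x y * S.E m x y) := by ring
    _ = (Fintype.card X : ℂ) * ∑ k, q l m k * S.E k x y := by
      rw [hk]; field_simp
    _ = _ := by
      rw [Finset.mul_sum]
      exact Finset.sum_congr rfl (fun k _ => by ring)

/-- Distinctness of the dual eigenvalues. -/
theorem theta_inj_s11 {X : Type*} [Fintype X] [DecidableEq X] [Nonempty X] {n : ℕ} (S : Scheme X n)
    (Q : Matrix (Fin (n + 1)) (Fin (n + 1)) ℂ) (hQ : S.IsQ Q)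
    (q : Fin (n + 1) → Fin (n + 1) → Fin (n + 1) → ℂ) (hcom : S.Cometric q)
    (e : Fin (n + 1)) (he : (e : ℕ) = 1)
    (i j : Fin (n + 1)) (hi : ∃ x y, S.A i x y = 1) (hj : ∃ x y, S.A j x y = 1)
    (h : Q i e = Q j e) : i = j := by
  have hX : (Fintype.card X : ℂ) ≠ 0 := by exact_mod_cast Fintype.card_ne_zero
  obtain ⟨x, y, hxy⟩ := hi
  obtain ⟨x', y', hxy'⟩ := hj
  apply isQ_rows S Q hQ
  suffices H : ∀ k : ℕ, ∀ m : Fin (n + 1), (m : ℕ) = k → Q i m = Q j m from fun m => H m m rfl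
  intro k
  induction k using Nat.strong_induction_on with
  | _ k ih =>
    intro m hm
    rcases Nat.eq_zero_or_pos k with h0 | hpos
    · have : m = 0 := Fin.ext (by simp [hm, h0])
      subst this
      rw [Q_eq S Q hQ x y i hxy, Q_eq S Q hQ x' y' j hxy', S.E_zero]
      simp
    · have hlt : k - 1 < n + 1 := by have := m.2; omega
      have hi' := Q_krein S Q hQ q hcom.1 x y i hxy e ⟨k - 1, hlt⟩
      have hj' := Q_krein S Q hQ q hcom.1 x' y' j hxy' e ⟨k - 1, hlt⟩
      rw [h, ih (k - 1) (by omega) ⟨k - 1, hlt⟩ rfl, hj'] at hi'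
      have hz : ∑ l, q e ⟨k - 1, hlt⟩ l * (Q j l - Q i l) = 0 := by
        simp only [mul_sub, Finset.sum_sub_distrib]
        rw [hi', sub_self]
      rw [Finset.sum_eq_single m] at hz
      · have hne := (hcom.2 e ⟨k - 1, hlt⟩ m).2 (by simp only [he, hm]; omega)
        have := (mul_eq_zero.mp hz).resolve_left hne
        exact (sub_eq_zero.mp this).symm
      · intro b _ hb
        have hbm : (b : ℕ) ≠ k := fun hh => hb (Fin.ext (by omega))
        rcases Nat.lt_or_gt_of_ne hbm with hl | hg
        · rw [ih b hl b rfl, sub_self, mul_zero]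
        · rw [(hcom.2 e ⟨k - 1, hlt⟩ b).1 (by simp only [he]; omega), zero_mul]
      · simp

/-- A Vandermonde argument. -/
theorem vander {ι : Type*} [DecidableEq ι] (T : Finset ι) (θ d : ι → ℂ)
    (hinj : ∀ i ∈ T, ∀ j ∈ T, θ i = θ j → i = j)
    (h : ∀ k < T.card, ∑ j ∈ T, d j * θ j ^ k = 0) : ∀ j ∈ T, d j = 0 := by
  intro j0 hj0
  let p : Polynomial ℂ := ∏ i ∈ T.erase j0, (Polynomial.X - Polynomial.C (θ i))
  have hdeg : p.natDegree < T.card := by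
    rw [Polynomial.natDegree_prod_of_monic _ _ (fun i _ => Polynomial.monic_X_sub_C _)]
    simp only [Polynomial.natDegree_X_sub_C, Finset.sum_const, smul_eq_mul, mul_one]
    exact Finset.card_erase_lt_of_mem hj0
  have hz : ∑ j ∈ T, d j * p.eval (θ j) = 0 := by
    simp only [Polynomial.eval_eq_sum_range' hdeg, Finset.mul_sum]
    rw [Finset.sum_comm]
    apply Finset.sum_eq_zero
    intro k hk
    have := h k (Finset.mem_range.mp hk)
    calc _ = p.coeff k * ∑ j ∈ T, d j * θ j ^ k := by
          rw [Finset.mul_sum]; exact Finset.sum_congr rfl (fun _ _ => by ring)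
      _ = 0 := by rw [this, mul_zero]
  rw [Finset.sum_eq_single j0] at hz
  · refine (mul_eq_zero.mp hz).resolve_right ?_
    simp only [p, Polynomial.eval_prod, Polynomial.eval_sub, Polynomial.eval_X, Polynomial.eval_C]
    refine Finset.prod_ne_zero_iff.mpr ?_
    intro i hi hh
    exact Finset.ne_of_mem_erase hi
      (hinj i (Finset.mem_of_mem_erase hi) j0 hj0 (sub_eq_zero.mp hh).symm)
  · intro b hb hne
    simp only [p, Polynomial.eval_prod]
    rw [Finset.prod_eq_zero (Finset.mem_erase.mpr ⟨hne, hb⟩) (by simp), mul_zero]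
  · exact fun hh => absurd hj0 hh

/-- A vanishing quadratic form of a Hermitian idempotent annihilates the vector. -/
theorem E_chi {X : Type*} [Fintype X] [DecidableEq X] {n : ℕ} (S : Scheme X n)
    (Y : Finset X) (k : Fin (n + 1)) (h : ∑ x ∈ Y, ∑ y ∈ Y, S.E k x y = 0) (x : X) :
    ∑ y ∈ Y, S.E k x y = 0 := by
  let χ : X → ℂ := fun x => if x ∈ Y then 1 else 0
  have hm : ∀ x, (S.E k *ᵥ χ) x = ∑ y ∈ Y, S.E k x y := by
    intro x
    simp [Matrix.mulVec, dotProduct, χ]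
  have hs : star χ = χ := by
    funext x
    by_cases hx : x ∈ Y <;> simp [χ, hx]
  have h1 : star (S.E k *ᵥ χ) ⬝ᵥ (S.E k *ᵥ χ) = 0 := by
    rw [Matrix.star_mulVec, (S.E_herm k).eq, hs, ← Matrix.dotProduct_mulVec,
      Matrix.mulVec_mulVec, S.E_mul, if_pos rfl]
    simp only [dotProduct, hm]
    simpa [χ] using h
  rw [dotProduct_star_self_eq_zero] at h1
  rw [← hm, h1]; rfl

/-- in a cometric scheme, a code with `δ* ≥ s` is regular. -/
theorem dual_distance_ge_degree_implies_regular {X : Type*} [Fintype X] [DecidableEq X]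
    [Nonempty X] {n : ℕ} (hn : 1 ≤ n) (S : Scheme X n) (hsym : S.IsSym)
    (q : Fin (n + 1) → Fin (n + 1) → Fin (n + 1) → ℂ) (hcom : S.Cometric q)
    (Q : Matrix (Fin (n + 1)) (Fin (n + 1)) ℂ) (hQ : S.IsQ Q)
    (Y : Finset X) (hY1 : 1 < Y.card) (hY2 : Y.card < Fintype.card X)
    (δs : Fin (n + 1))
    (hδs : IsLeast {i : Fin (n + 1) | i ≠ 0 ∧ macT Q (innerDist S Y) i ≠ 0} δs)
    (hge : Nat.card {i : Fin (n + 1) | i ≠ 0 ∧ innerDist S Y i ≠ 0} ≤ (δs : ℕ)) :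
    Regular S Y := by
  classical
  have hX : (Fintype.card X : ℂ) ≠ 0 := by exact_mod_cast Fintype.card_ne_zero
  have hYc : (Y.card : ℂ) ≠ 0 := by
    have : Y.card ≠ 0 := by omega
    exact_mod_cast this
  have ha : ∀ j, innerDist S Y j = (Y.card : ℂ)⁻¹ * ∑ x ∈ Y, outerB S Y x j := fun j => rfl
  have hF : ∀ x k, ∑ j, outerB S Y x j * Q j k = (Fintype.card X : ℂ) * ∑ y ∈ Y, S.E k x y := by
    intro x k
    simp only [outerB, Finset.mul_sum, E_apply S Q hQ, Finset.sum_mul]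
    rw [Finset.sum_comm]
    exact Finset.sum_congr rfl (fun _ _ => Finset.sum_congr rfl (fun _ _ => mul_comm _ _))
  have haF : ∀ k, ∑ j, innerDist S Y j * Q j k =
      (Y.card : ℂ)⁻¹ * ∑ x ∈ Y, ∑ j, outerB S Y x j * Q j k := by
    intro k
    simp only [ha]
    rw [Finset.sum_comm, Finset.mul_sum]
    exact Finset.sum_congr rfl (fun _ _ => by rw [mul_assoc, Finset.sum_mul])
  -- the difference vector is orthogonal to the first columns of `Q`
  have hd : ∀ x, ∀ k : Fin (n + 1), k < δs →
      ∑ j, (outerB S Y x j - innerDist S Y j) * Q j k = 0 := by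
    intro x k hk
    simp only [sub_mul, Finset.sum_sub_distrib]
    rw [sub_eq_zero]
    by_cases hk0 : k = 0
    · subst hk0
      rw [haF]
      simp only [hF, S.E_zero]
      simp
      field_simp
    · have hz : macT Q (innerDist S Y) k = 0 := by
        by_contra hne
        exact absurd (hδs.2 ⟨hk0, hne⟩) (not_le.mpr hk)
      have hz' : ∑ j, innerDist S Y j * Q j k = 0 := hz
      rw [hz', hF]
      rw [haF] at hz'
      simp only [hF, ← Finset.mul_sum] at hz'
      have h3 := (mul_eq_zero.mp ((mul_eq_zero.mp hz').resolve_left (inv_ne_zero hYc))).resolve_left hX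
      rw [E_chi S Y k h3 x, mul_zero]
  -- vanishing of inner distribution
  have hzero : ∀ j, innerDist S Y j = 0 → ∀ x ∈ Y, ∀ y ∈ Y, S.A j x y = 0 := by
    intro j hj
    have h1 := (mul_eq_zero.mp hj).resolve_left (inv_ne_zero hYc)
    have hnn : ∀ x y, 0 ≤ S.A j x y := by
      intro x y
      rcases S.A_zeroOne j x y with h | h <;> simp [h]
    rw [Finset.sum_eq_zero_iff_of_nonneg (fun x _ => Finset.sum_nonneg (fun y _ => hnn x y))] at h1
    intro x hx y hy
    exact (Finset.sum_eq_zero_iff_of_nonneg (fun y _ => hnn x y)).mp (h1 x hx) y hy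
  have hnz : ∀ j, innerDist S Y j ≠ 0 → ∃ x y, S.A j x y = 1 := by
    intro j hj
    by_contra hcon
    push Not at hcon
    apply hj
    have : ∀ x y, S.A j x y = 0 := fun x y => (S.A_zeroOne j x y).resolve_right (hcon x y)
    simp [innerDist, this]
  let T : Finset (Fin (n + 1)) := Finset.univ.filter fun i => i ≠ 0 ∧ innerDist S Y i ≠ 0
  have hT : T.card ≤ (δs : ℕ) := by
    have : Nat.card {i : Fin (n + 1) | i ≠ 0 ∧ innerDist S Y i ≠ 0} = T.card := by
      rw [Nat.card_eq_fintype_card, Fintype.card_ofFinset]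
      rfl
    omega
  have hTmem : ∀ j, j ∈ T ↔ j ≠ 0 ∧ innerDist S Y j ≠ 0 := by intro j; simp [T]
  have hB0 : ∀ x ∈ Y, outerB S Y x 0 = 1 := by
    intro x hx
    simp [outerB, S.A_zero, Matrix.one_apply, hx]
  have ha0 : innerDist S Y 0 = 1 := by
    rw [ha, Finset.sum_congr rfl hB0]
    simp [hYc]
  intro x hx
  have hout : ∀ j, j ∉ T → outerB S Y x j - innerDist S Y j = 0 := by
    intro j hj
    by_cases hj0 : j = 0
    · subst hj0
      rw [hB0 x hx, ha0, sub_self]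
    · have hj' : innerDist S Y j = 0 := by
        by_contra hne
        exact hj ((hTmem j).mpr ⟨hj0, hne⟩)
      rw [hj', sub_zero]
      exact Finset.sum_eq_zero (fun y hy => hzero j hj' x hx y hy)
  have hdT : ∀ k : Fin (n + 1), k < δs →
      ∑ j ∈ T, (outerB S Y x j - innerDist S Y j) * Q j k = 0 := by
    intro k hk
    rw [← hd x k hk]
    apply Finset.sum_subset (Finset.subset_univ _)
    intro j _ hj
    rw [hout j hj, zero_mul]
  let e : Fin (n + 1) := ⟨1, by omega⟩
  have hpow : ∀ k : ℕ, ∀ m : Fin (n + 1), (m : ℕ) + k < (δs : ℕ) →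
      ∑ j ∈ T, (outerB S Y x j - innerDist S Y j) * (Q j e ^ k * Q j m) = 0 := by
    intro k
    induction k with
    | zero =>
      intro m hm
      simpa using hdT m (by rw [Fin.lt_def]; omega)
    | succ k ih =>
      intro m hm
      have hstep : ∀ j ∈ T, (outerB S Y x j - innerDist S Y j) * (Q j e ^ (k + 1) * Q j m) =
          ∑ l, q e m l * ((outerB S Y x j - innerDist S Y j) * (Q j e ^ k * Q j l)) := by
        intro j hj
        obtain ⟨u, v, huv⟩ := hnz j ((hTmem j).mp hj).2
        have hk := Q_krein S Q hQ q hcom.1 u v j huv e m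
        calc _ = (outerB S Y x j - innerDist S Y j) * Q j e ^ k * (Q j e * Q j m) := by ring
          _ = _ := by
            rw [hk, Finset.mul_sum]
            exact Finset.sum_congr rfl (fun _ _ => by ring)
      rw [Finset.sum_congr rfl hstep, Finset.sum_comm]
      apply Finset.sum_eq_zero
      intro l _
      rw [← Finset.mul_sum]
      by_cases hl : 1 + (m : ℕ) < (l : ℕ)
      · rw [(hcom.2 e m l).1 hl, zero_mul]
      · rw [ih l (by omega), mul_zero]
  have hfin := vander T (fun j => Q j e) (fun j => outerB S Y x j - innerDist S Y j)
    (fun i hi j hj hij => theta_inj_s11 S Q hQ q hcom e rfl i j (hnz i ((hTmem i).mp hi).2)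
      (hnz j ((hTmem j).mp hj).2) hij)
    (by
      intro k hk
      rw [← hpow k 0 (by simp; omega)]
      apply Finset.sum_congr rfl
      intro j hj
      obtain ⟨u, v, huv⟩ := hnz j ((hTmem j).mp hj).2
      have h1 : Q j 0 = 1 := by
        rw [Q_eq S Q hQ u v j huv, S.E_zero]
        simp [hX]
      rw [h1, mul_one])
  intro i
  by_cases hi : i ∈ T
  · exact sub_eq_zero.mp (hfin i hi)
  · exact sub_eq_zero.mp (hout i hi)

end AssocScheme
end

section
/- Let (X, R) be a symmetric association scheme with n classes that is metric with respect to the ordering A_0, …, A_n, and let Y ⊆ X with 1 < |Y| < |X|, with width w and dual degree s*. Then w ≥ n − s*, and if w = n − s* then Y is completely regular. -/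
open Matrix BigOperators
open scoped ComplexOrder

namespace AssocScheme

lemma tri_low (m : ℕ) (f : Fin m → ℕ → ℂ) (h0 : ∀ (k : Fin m) (i : ℕ), i < (k : ℕ) → f k i = 0)
    (h1 : ∀ k : Fin m, f k (k : ℕ) ≠ 0) (c : Fin m → ℂ) (l : ℕ)
    (hz : ∀ i, i < l → ∑ k, c k * f k i = 0) : ∀ k : Fin m, (k : ℕ) < l → c k = 0 := by
  have key : ∀ N : ℕ, ∀ k : Fin m, (k : ℕ) = N → (k : ℕ) < l → c k = 0 := by
    intro N
    induction N using Nat.strong_induction_on with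
    | _ N ih =>
      intro k hk hl
      have h := hz k hl
      rw [Finset.sum_eq_single k] at h
      · exact (mul_eq_zero.mp h).resolve_right (h1 k)
      · intro b _ hb
        rcases lt_or_gt_of_ne (fun h => hb (Fin.ext h) : (b : ℕ) ≠ k) with hlt | hgt
        · rw [ih b (by omega) b rfl (by omega), zero_mul]
        · rw [h0 b k hgt, mul_zero]
      · intro h; exact absurd (Finset.mem_univ _) h
  exact fun k hk => key k k rfl hk

lemma tri_high (m w : ℕ) (f : Fin m → ℕ → ℂ) (h0 : ∀ (k : Fin m) (i : ℕ), (k : ℕ) + w < i → f k i = 0)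
    (h1 : ∀ k : Fin m, f k ((k : ℕ) + w) ≠ 0) (c : Fin m → ℂ) (l : ℕ)
    (hz : ∀ i, l + w < i → ∑ k, c k * f k i = 0) : ∀ k : Fin m, l < (k : ℕ) → c k = 0 := by
  have key : ∀ N : ℕ, ∀ k : Fin m, m - (k : ℕ) = N → l < (k : ℕ) → c k = 0 := by
    intro N
    induction N using Nat.strong_induction_on with
    | _ N ih =>
      intro k hk hl
      have h := hz (k + w) (by omega)
      rw [Finset.sum_eq_single k] at h
      · exact (mul_eq_zero.mp h).resolve_right (h1 k)
      · intro b _ hb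
        have hbm := b.2
        rcases lt_or_gt_of_ne (fun h => hb (Fin.ext h) : (b : ℕ) ≠ k) with hlt | hgt
        · rw [h0 b (k + w) (by omega), mul_zero]
        · rw [ih (m - b) (by omega) b rfl (by omega), zero_mul]
      · intro h; exact absurd (Finset.mem_univ _) h
  exact fun k hk => key _ k rfl hk

lemma core {X : Type*} (n s w : ℕ) (hs : s ≤ n) (d : X → X → ℕ)
    (d_symm : ∀ x y, d x y = d y x)
    (d_tri : ∀ x y z, d x z ≤ d x y + d y z)
    (d_geo : ∀ x z i j, d x z = i + j → ∃ y, d x y = i ∧ d y z = j)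
    (d_far : ∀ y, ∃ z, d y z = n)
    (Y : Finset X) (hY : Y.Nonempty) (hw : ∀ y ∈ Y, ∀ y' ∈ Y, d y y' ≤ w)
    (r : X → ℕ → ℂ) (hr : ∀ x i, r x i = ∑ y ∈ Y, if d x y = i then 1 else 0)
    (V : Submodule ℂ (ℕ → ℂ)) [FiniteDimensional ℂ V] (hV : Module.finrank ℂ V ≤ s + 1)
    (hrV : ∀ x, r x ∈ V) (N : ℕ) (hdN : ∀ x y, d x y < N) (m : X → ℕ)
    (hm1 : ∀ x, ∃ y ∈ Y, d x y = m x) (hm2 : ∀ x, ∀ y ∈ Y, m x ≤ d x y) :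
    n - s ≤ w ∧ (w = n - s → ∀ x x', m x = m x' → r x = r x') := by
  have hXne : Nonempty X := ⟨hY.choose⟩
  have r_ne : ∀ x i, r x i ≠ 0 ↔ ∃ y ∈ Y, d x y = i := by
    intro x i
    rw [hr, Finset.sum_boole, Nat.cast_ne_zero, Finset.card_ne_zero]
    simp [Finset.Nonempty]
  have r_low : ∀ x i, i < m x → r x i = 0 := by
    intro x i hi
    by_contra h
    obtain ⟨y, hy, rfl⟩ := (r_ne x i).1 h
    have := hm2 x y hy
    omega
  have r_m : ∀ x, r x (m x) ≠ 0 := fun x => (r_ne x _).2 (hm1 x)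
  have r_high : ∀ x i, m x + w < i → r x i = 0 := by
    intro x i hi
    by_contra h
    obtain ⟨y, hy, rfl⟩ := (r_ne x i).1 h
    obtain ⟨y', hy', h'⟩ := hm1 x
    have := d_tri x y' y
    have := hw y' hy' y hy
    omega
  -- points along a geodesic from `z` to a nearest point `y'`
  have path : ∀ z y', y' ∈ Y → d z y' = m z → ∀ k, k ≤ m z →
      ∃ x, d x y' = k ∧ d z x = m z - k ∧ m x = k := by
    intro z y' hy' hz k hk
    obtain ⟨x, h1, h2⟩ := d_geo z y' (m z - k) k (by omega)
    refine ⟨x, h2, h1, ?_⟩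
    have a1 := hm2 x y' hy'
    obtain ⟨y2, hy2, h3⟩ := hm1 x
    have a2 := hm2 z y2 hy2
    have a3 := d_tri z x y2
    omega
  have indep : ∀ t (x : Fin t → X), (∀ k, m (x k) = k) → LinearIndependent ℂ (fun k => r (x k)) := by
    intro t x hx
    rw [Fintype.linearIndependent_iff]
    intro c hc k
    refine tri_low t (fun k => r (x k)) (fun k i hi => r_low _ _ (by rw [hx]; exact hi)) 
      (fun k => by have := r_m (x k); rwa [hx] at this) c (k + 1) ?_ k (by omega)
    intro i _
    have := congrFun hc i
    simpa [Finset.sum_apply] using this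
  have cov : ∀ z, m z ≤ s := by
    intro z
    obtain ⟨y', hy', hz⟩ := hm1 z
    choose! x h1 h2 h3 using path z y' hy' hz
    have li := indep (m z + 1) (fun k => x k) (fun k => h3 k (by omega))
    have li' : LinearIndependent ℂ (fun k : Fin (m z + 1) => (⟨r (x k), hrV _⟩ : V)) :=
      LinearIndependent.of_comp V.subtype li
    have := li'.fintype_card_le_finrank
    simp at this
    omega
  obtain ⟨y0, hy0⟩ := hY
  obtain ⟨z, hz⟩ := d_far y0
  obtain ⟨y', hy', hzy⟩ := hm1 z
  have t1 := d_tri y0 y' z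
  have t2 := hw y0 hy0 y' hy'
  have t3 := cov z
  have t4 := d_symm y' z
  refine ⟨by omega, ?_⟩
  intro hweq
  have hms : m z = s := by omega
  choose! x h1 h2 h3 using path z y' hy' hzy
  have hx3 : ∀ k : Fin (s + 1), m (x k) = k := fun k => h3 k (by omega)
  have li := indep (s + 1) (fun k => x k) hx3
  have li' : LinearIndependent ℂ (fun k : Fin (s + 1) => (⟨r (x k), hrV _⟩ : V)) :=
    LinearIndependent.of_comp V.subtype li
  have hspan : Submodule.span ℂ (Set.range (fun k : Fin (s + 1) => (⟨r (x k), hrV _⟩ : V))) = ⊤ := by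
    apply li'.span_eq_top_of_card_eq_finrank'
    have := li'.fintype_card_le_finrank
    simp at this ⊢
    omega
  have rsum : ∀ u, ∑ i ∈ Finset.range N, r u i = Y.card := by
    intro u
    simp only [hr]
    rw [Finset.sum_comm]
    simp [hdN]
  have hYc : (Y.card : ℂ) ≠ 0 := by
    simpa using Finset.ne_empty_of_mem hy0
  have main : ∀ u, r u = r (x (m u)) := by
    intro u
    have hu : (⟨r u, hrV u⟩ : V) ∈ Submodule.span ℂ (Set.range (fun k : Fin (s + 1) => (⟨r (x k), hrV _⟩ : V))) := by
      rw [hspan]; trivial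
    rw [Submodule.mem_span_range_iff_exists_fun] at hu
    obtain ⟨c, hc⟩ := hu
    have hc' : ∀ i, ∑ k : Fin (s + 1), c k * r (x k) i = r u i := by
      intro i
      have := congrFun (congrArg Subtype.val hc) i
      simpa [Finset.sum_apply] using this
    have cl := tri_low (s + 1) (fun k => r (x k)) (fun k i hi => r_low _ _ (by rw [hx3]; exact hi))
      (fun k => by have := r_m (x k); rwa [hx3] at this) c (m u)
      (fun i hi => by rw [hc']; exact r_low u i hi)
    have ch := tri_high (s + 1) w (fun k => r (x k))
      (fun k i hi => r_high _ _ (by rw [hx3]; exact hi))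
      (fun k => by
        rw [r_ne]
        refine ⟨y0, hy0, ?_⟩
        have a1 := h1 k (by omega)
        have a2 := h2 k (by omega)
        have a3 := d_tri (x k) y' y0
        have a4 := d_tri z (x k) y0
        have a5 := d_symm z y0
        have a6 := d_symm y' y0
        omega) c (m u)
      (fun i hi => by rw [hc']; exact r_high u i hi)
    have hmu := cov u
    have hone : ∀ i, c ⟨m u, by omega⟩ * r (x (m u)) i = r u i := by
      intro i
      rw [← hc', Finset.sum_eq_single (⟨m u, by omega⟩ : Fin (s + 1))]
      · intro b _ hb
        rcases lt_or_gt_of_ne (fun h => hb (Fin.ext h) : (b : ℕ) ≠ m u) with hlt | hgt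
        · rw [cl b hlt, zero_mul]
        · rw [ch b hgt, zero_mul]
      · intro h; exact absurd (Finset.mem_univ _) h
    have hsum := rsum u
    simp only [← hone] at hsum
    rw [← Finset.mul_sum, rsum] at hsum
    have hc1 : c ⟨m u, by omega⟩ = 1 := mul_right_cancel₀ hYc (by rw [hsum, one_mul])
    funext i
    rw [← hone i, hc1, one_mul]
  intro a b hab
  rw [main a, main b, hab]

/-- in a metric scheme, the width satisfies `w ≥ n − s*`, and if
`w = n − s*` then `Y` is completely regular. -/
theorem width_bound {X : Type*} [Fintype X] [DecidableEq X]
    [Nonempty X] {n : ℕ} (hn : 1 ≤ n) (S : Scheme X n) (hsym : S.IsSym) (hmet : S.Metric)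
    (P Q : Matrix (Fin (n + 1)) (Fin (n + 1)) ℂ) (hP : S.IsP P) (hQ : S.IsQ Q)
    (Y : Finset X) (hY1 : 1 < Y.card) (hY2 : Y.card < Fintype.card X)
    (w : Fin (n + 1))
    (hw : IsGreatest {i : Fin (n + 1) | innerDist S Y i ≠ 0} w) :
    n - Nat.card {i : Fin (n + 1) | i ≠ 0 ∧ macT Q (innerDist S Y) i ≠ 0} ≤ (w : ℕ) ∧
      ((w : ℕ) = n - Nat.card {i : Fin (n + 1) | i ≠ 0 ∧ macT Q (innerDist S Y) i ≠ 0} →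
        CompletelyRegular S Y) := by
  classical
  have hYne : Y.Nonempty := Finset.card_pos.1 (by omega)
  have hYc : (Y.card : ℂ) ≠ 0 := by
    rw [Nat.cast_ne_zero]; omega
  have hXc : (Fintype.card X : ℂ) ≠ 0 := by
    rw [Nat.cast_ne_zero]; omega
  -- the distance function
  have hex : ∀ x y, ∃ i : Fin (n + 1), ∀ j, S.A j x y = if i = j then 1 else 0 := by
    intro x y
    have hs : ∑ i, S.A i x y = 1 := by
      have := congrFun (congrFun S.A_sum x) y
      simpa [Matrix.sum_apply] using this
    have hb : ∀ i, S.A i x y = if S.A i x y = 1 then 1 else 0 := by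
      intro i
      rcases S.A_zeroOne i x y with h | h <;> simp [h]
    have hs2 : ∑ i, (if S.A i x y = 1 then (1 : ℂ) else 0) = 1 := by
      exact (Finset.sum_congr rfl fun i _ => (hb i).symm).trans hs
    rw [Finset.sum_boole, Nat.cast_eq_one, Finset.card_eq_one] at hs2
    obtain ⟨i, hi⟩ := hs2
    refine ⟨i, fun j => ?_⟩
    have hj : S.A j x y = 1 ↔ j = i := by
      have : j ∈ ({j | S.A j x y = 1} : Finset (Fin (n + 1))) ↔ j ∈ ({i} : Finset (Fin (n + 1))) := by
        rw [hi]
      simpa using this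
    rw [hb j]
    simp only [hj, eq_comm]
  choose d hd using hex
  have mul_apply' : ∀ i j x z, (S.A i * S.A j) x z = S.p i j (d x z) := by
    intro i j x z
    rw [S.A_mul]
    simp [Matrix.sum_apply, hd]
  have mul_cnt : ∀ i j x z, S.p i j (d x z) ≠ 0 ↔ ∃ y, d x y = i ∧ d y z = j := by
    intro i j x z
    rw [← mul_apply', Matrix.mul_apply]
    simp only [hd, ← ite_and, mul_ite, mul_one, mul_zero]
    rw [Finset.sum_boole, Nat.cast_ne_zero, Finset.card_ne_zero]
    simp [Finset.Nonempty, and_comm]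
  have d_symm : ∀ x y, d x y = d y x := by
    intro x y
    have h := congrFun (congrFun (hsym (d y x)) x) y
    rw [Matrix.transpose_apply, hd, hd] at h
    by_contra hne
    simp [hne] at h
  have E_indep : LinearIndependent ℂ S.E := by
    rw [Fintype.linearIndependent_iff]
    intro c hc i
    have h := congrArg (S.E i * ·) hc
    simp only [Matrix.mul_sum, Matrix.mul_smul, S.E_mul, Matrix.mul_zero] at h
    simp at h
    exact h.resolve_right (S.E_ne i)
  have A_indep : LinearIndependent ℂ S.A := by
    rw [linearIndependent_iff_card_le_finrank_span]
    have h1 : Submodule.span ℂ (Set.range S.E) ≤ Submodule.span ℂ (Set.range S.A) := by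
      rw [Submodule.span_le]
      rintro _ ⟨i, rfl⟩
      exact S.E_span i
    have h2 := Submodule.finrank_mono h1
    rw [finrank_span_eq_card E_indep] at h2
    exact h2
  have d_far : ∀ y, ∃ z, d y z = Fin.last n := by
    have hne := A_indep.ne_zero (Fin.last n)
    obtain ⟨a, b, hab⟩ : ∃ a b, d a b = Fin.last n := by
      by_contra hcon
      push Not at hcon
      apply hne
      ext a b
      simp [hd, hcon a b]
    have d0 : ∀ x, d x x = 0 := by
      intro x
      have h := hd x x 0
      rw [S.A_zero] at h
      by_contra hc
      simp [hc] at h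
    have h1 : S.p (Fin.last n) (Fin.last n) 0 ≠ 0 := by
      rw [← d0 a, mul_cnt]
      exact ⟨b, hab, by rw [d_symm, hab]⟩
    intro y
    rw [← d0 y, mul_cnt] at h1
    obtain ⟨z, hz, _⟩ := h1
    exact ⟨z, hz⟩
  set T := {i : Fin (n + 1) | i ≠ 0 ∧ macT Q (innerDist S Y) i ≠ 0} with hT
  set χ : X → ℂ := fun x => if x ∈ Y then 1 else 0 with hχ
  have hEχ : ∀ i, i ≠ 0 → i ∉ T → S.E i *ᵥ χ = 0 := by
    intro i hi0 hiT
    have hmac : macT Q (innerDist S Y) i = 0 := by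
      by_contra h; exact hiT ⟨hi0, h⟩
    have hq : χ ⬝ᵥ (S.E i *ᵥ χ) = 0 := by
      have e1 : χ ⬝ᵥ (S.E i *ᵥ χ) = ∑ x ∈ Y, ∑ y ∈ Y, S.E i x y := by
        simp [dotProduct, mulVec, hχ, Finset.sum_ite_mem]
      have e2 : macT Q (innerDist S Y) i = (Y.card : ℂ)⁻¹ * (Fintype.card X : ℂ) *
          ∑ x ∈ Y, ∑ y ∈ Y, S.E i x y := by
        rw [hQ i]
        simp only [macT, innerDist, Matrix.smul_apply, Matrix.sum_apply, smul_eq_mul,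
          ← Finset.mul_sum]
        rw [mul_assoc, ← mul_assoc (Fintype.card X : ℂ), mul_inv_cancel₀ hXc, one_mul]
        have e3 : ∑ x ∈ Y, ∑ y ∈ Y, ∑ j, Q j i * S.A j x y
            = ∑ j, Q j i * ∑ x ∈ Y, ∑ y ∈ Y, S.A j x y := by
          simp only [Finset.mul_sum]
          rw [Finset.sum_comm]
          conv_rhs => rw [Finset.sum_comm]
          rw [Finset.sum_comm]
          refine Finset.sum_congr rfl fun x _ => ?_
          rw [Finset.sum_comm]
        rw [e3, Finset.mul_sum]
        refine Finset.sum_congr rfl fun j _ => by ring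
      rw [e1]
      rw [e2] at hmac
      have : (Y.card : ℂ)⁻¹ * (Fintype.card X : ℂ) ≠ 0 := mul_ne_zero (inv_ne_zero hYc) hXc
      exact (mul_eq_zero.mp hmac).resolve_left this
    have hstar : star χ = χ := by
      ext x; simp [hχ]
    rw [← dotProduct_star_self_eq_zero, star_mulVec, (S.E_herm i).eq, hstar]
    rw [← dotProduct_mulVec, mulVec_mulVec, S.E_mul, if_pos rfl]
    exact hq
  -- rows
  set r : X → ℕ → ℂ := fun x i => if h : i < n + 1 then outerB S Y x ⟨i, h⟩ else 0 with hrdef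
  have hr : ∀ x i, r x i = ∑ y ∈ Y, if (d x y : ℕ) = i then 1 else 0 := by
    intro x i
    simp only [hrdef]
    split_ifs with h
    · simp [outerB, hd, Fin.ext_iff]
    · symm
      refine Finset.sum_eq_zero fun y _ => if_neg ?_
      have := (d x y).2
      omega
  set Pf : Fin (n + 1) → ℕ → ℂ := fun j i => if h : i < n + 1 then P j ⟨i, h⟩ else 0 with hPf
  let T' : Finset (Fin (n + 1)) := insert 0 T.toFinset
  have hTcard : Nat.card T = T.toFinset.card := by
    rw [Nat.card_eq_fintype_card, Set.toFinset_card]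
  let V : Submodule ℂ (ℕ → ℂ) := Submodule.span ℂ ((T'.image Pf : Finset (ℕ → ℂ)) : Set (ℕ → ℂ))
  have hVr : Module.finrank ℂ V ≤ Nat.card T + 1 := by
    rw [hTcard]
    refine (finrank_span_finset_le_card _).trans (Finset.card_image_le.trans ?_)
    exact Finset.card_insert_le _ _
  have hTn : Nat.card T ≤ n := by
    rw [hTcard]
    have h0 : T.toFinset ⊆ Finset.univ.erase 0 := by
      intro i hi
      rw [Set.mem_toFinset] at hi
      simpa using hi.1
    have := Finset.card_le_card h0
    simpa using this
  have hrV : ∀ x, r x ∈ V := by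
    intro x
    have e : r x = ∑ j ∈ T', (S.E j *ᵥ χ) x • Pf j := by
      have e0 : r x = ∑ j, (S.E j *ᵥ χ) x • Pf j := by
        funext i
        rw [Finset.sum_apply]
        simp only [hrdef, hPf, Pi.smul_apply, smul_eq_mul]
        split_ifs with h
        · have : outerB S Y x ⟨i, h⟩ = (S.A ⟨i, h⟩ *ᵥ χ) x := by
            simp [outerB, mulVec, dotProduct, hχ]
          rw [this, hP ⟨i, h⟩, Matrix.sum_mulVec, Finset.sum_apply]
          refine Finset.sum_congr rfl fun j _ => ?_
          rw [Matrix.smul_mulVec, Pi.smul_apply, smul_eq_mul, mul_comm]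
        · simp
      rw [e0]
      symm
      apply Finset.sum_subset (Finset.subset_univ _)
      intro j _ hj
      have hj' : j ≠ 0 ∧ j ∉ T := by
        simpa [T'] using hj
      rw [hEχ j hj'.1 hj'.2]
      simp
    rw [e]
    refine Submodule.sum_mem _ fun j hj => Submodule.smul_mem _ _ (Submodule.subset_span ?_)
    exact Finset.mem_coe.2 (Finset.mem_image_of_mem _ hj)
  have hwY : ∀ y ∈ Y, ∀ y' ∈ Y, ((d y y' : Fin (n + 1)) : ℕ) ≤ w := by
    intro y hy y' hy'
    have : innerDist S Y (d y y') ≠ 0 := by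
      simp only [innerDist, hd]
      refine mul_ne_zero (inv_ne_zero hYc) ?_
      rw [← Finset.sum_product', Finset.sum_boole, Nat.cast_ne_zero, Finset.card_ne_zero]
      exact ⟨(y, y'), by simp [hy, hy']⟩
    exact hw.2 this
  have hmne : ∀ x, {j : ℕ | ∃ y ∈ Y, (d x y : ℕ) = j}.Nonempty := fun x => by
    obtain ⟨y, hy⟩ := hYne
    exact ⟨_, y, hy, rfl⟩
  have hfin := core n (Nat.card T) w hTn (fun x y => (d x y : ℕ))
    (fun x y => by rw [d_symm])
    (fun x y z => by
      by_contra h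
      have h1 := (hmet (d x y) (d y z) (d x z)).1 (by omega)
      exact (mul_cnt (d x y) (d y z) x z).2 ⟨y, rfl, rfl⟩ h1)
    (fun x z i j h => by
      have hlt := (d x z).2
      have h1 := (hmet ⟨i, by omega⟩ ⟨j, by omega⟩ (d x z)).2 h
      rw [mul_cnt] at h1
      obtain ⟨y, a, b⟩ := h1
      exact ⟨y, by rw [a], by rw [b]⟩)
    (fun y => by
      obtain ⟨z, hz⟩ := d_far y
      exact ⟨z, by rw [hz]; rfl⟩)
    Y hYne hwY r hr V hVr hrV (n + 1) (fun x y => (d x y).2)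
    (fun x => sInf {j : ℕ | ∃ y ∈ Y, (d x y : ℕ) = j})
    (fun x => Nat.sInf_mem (hmne x))
    (fun x y hy => Nat.sInf_le ⟨y, hy, rfl⟩)
  refine ⟨hfin.1, fun hweq => ?_⟩
  have hf := hfin.2 hweq
  have hB : ∀ x (i : Fin (n + 1)), outerB S Y x i = r x i := by
    intro x i
    simp only [hrdef]
    rw [dif_pos i.2]
  have hinf : ∀ x, sInf {j : ℕ | outerB S Y x (Fin.ofNat (n + 1) j) ≠ 0} =
      sInf {j : ℕ | ∃ y ∈ Y, (d x y : ℕ) = j} := by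
    intro x
    have hmem : ∀ j : ℕ, outerB S Y x (Fin.ofNat (n + 1) j) ≠ 0 ↔
        ∃ y ∈ Y, (d x y : ℕ) = j % (n + 1) := by
      intro j
      rw [hB, hr, Finset.sum_boole, Nat.cast_ne_zero, Finset.card_ne_zero]
      simp [Finset.Nonempty]
    apply le_antisymm
    · obtain ⟨y, hy, h⟩ := Nat.sInf_mem (hmne x)
      apply Nat.sInf_le
      rw [Set.mem_ofPred_eq, hmem]
      refine ⟨y, hy, ?_⟩
      rw [Nat.mod_eq_of_lt (by rw [← h]; exact (d x y).2), h]
    · apply le_csInf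
      · obtain ⟨y, hy, h⟩ := Nat.sInf_mem (hmne x)
        refine ⟨(d x y : ℕ), ?_⟩
        rw [Set.mem_ofPred_eq, hmem]
        exact ⟨y, hy, (Nat.mod_eq_of_lt (d x y).2).symm⟩
      · intro j hj
        rw [Set.mem_ofPred_eq, hmem] at hj
        exact (Nat.sInf_le hj).trans (Nat.mod_le _ _)
  intro x x' hxx i
  have hxx' : sInf {j : ℕ | outerB S Y x (Fin.ofNat (n + 1) j) ≠ 0} =
      sInf {j : ℕ | outerB S Y x' (Fin.ofNat (n + 1) j) ≠ 0} := hxx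
  rw [hinf, hinf] at hxx'
  rw [hB, hB, hf x x' hxx']

end AssocScheme
end
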